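/- Let λ be a partition of the form λ = (μ_1,…,μ_k,1,…,1) for some partition μ = (μ_1,…,μ_k). If |μ| ≤ 6, then for every natural unit interval graph G the coefficient c_λ(q) of e_λ in X_G(x;q) is a polynomial in q with nonnegative coefficients. If |μ| ≤ 11, then for every natural unit interval graph G the coefficient c_λ of e_λ in X_G(x) is nonnegative. -/

import Mathlib

open Finset MvPolynomial
open scoped Classical

noncomputable section

/-- `κ` is a proper colouring of `G`. -/
def IsProper {n N : ℕ} (G : SimpleGraph (Fin n)) (κ : Fin n → Fin N) : Prop :=
  ∀ i j, G.Adj i j → κ i ≠ κ j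

/-- The chromatic symmetric function of `G`, truncated to `N` variables. -/
def chromSym (n N : ℕ) (G : SimpleGraph (Fin n)) : MvPolynomial (Fin N) ℤ :=
  ∑ κ : Fin n → Fin N, if IsProper G κ then ∏ i, X (κ i) else 0

/-- The number of ascents of a colouring. -/
def ascNum {n N : ℕ} (G : SimpleGraph (Fin n)) (κ : Fin n → Fin N) : ℕ :=
  ((Finset.univ : Finset (Fin n × Fin n)).filter fun p =>
    G.Adj p.1 p.2 ∧ p.1 < p.2 ∧ κ p.1 < κ p.2).card

/-- The chromatic quasisymmetric function of `G`, with coefficients in `ℤ[q]`,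
truncated to `N` variables. -/
def chromQSym (n N : ℕ) (G : SimpleGraph (Fin n)) :
    MvPolynomial (Fin N) (Polynomial ℤ) :=
  ∑ κ : Fin n → Fin N, if IsProper G κ then
    C (Polynomial.X ^ ascNum G κ) * ∏ i, X (κ i) else 0

/-- `e_λ`, the product of elementary symmetric polynomials over the parts of `λ`. -/
def eProd (N : ℕ) (R : Type) [CommSemiring R] {n : ℕ} (p : Nat.Partition n) :
    MvPolynomial (Fin N) R :=
  (p.parts.map fun k => esymm (Fin N) R k).prod

/-- The number of parts of a partition, i.e. `λ'_1`. -/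
def numParts {n : ℕ} (p : Nat.Partition n) : ℕ := Multiset.card p.parts

/-- The largest part `λ_1` of a partition. -/
def maxPart {n : ℕ} (p : Nat.Partition n) : ℕ := p.parts.sup

/-- `λ'_1 + ⋯ + λ'_k`, the number of cells in the first `k` columns of `λ`. -/
def conjSum {n : ℕ} (p : Nat.Partition n) (k : ℕ) : ℕ :=
  (p.parts.map fun a => min a k).sum

/-- `λ_1 + ⋯ + λ_k`, the number of cells in the first `k` rows of `λ`. -/
def partSum {n : ℕ} (p : Nat.Partition n) (k : ℕ) : ℕ :=
  ∑ j ∈ Finset.Icc 1 n, min (Multiset.card (p.parts.filter fun a => j ≤ a)) k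

/-- `s` is an independent set of vertices of `G`. -/
def IsIndepFinset {V : Type} (G : SimpleGraph V) (s : Finset V) : Prop :=
  ∀ i ∈ s, ∀ j ∈ s, ¬ G.Adj i j

/-- `s` is a clique of `G`. -/
def IsCliqueFinset {V : Type} (G : SimpleGraph V) (s : Finset V) : Prop :=
  ∀ i ∈ s, ∀ j ∈ s, i ≠ j → G.Adj i j

/-- The independence number `α(G)`. -/
def indepNum {n : ℕ} (G : SimpleGraph (Fin n)) : ℕ :=
  sSup {k | ∃ s : Finset (Fin n), IsIndepFinset G s ∧ s.card = k}

/-- The clique number `ω(G)`. -/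
def cliqueNum {n : ℕ} (G : SimpleGraph (Fin n)) : ℕ :=
  sSup {k | ∃ s : Finset (Fin n), IsCliqueFinset G s ∧ s.card = k}

/-- `α_k(G)`: the maximum number of vertices in an independent partition
with `k` blocks. -/
def alphaK {n : ℕ} (G : SimpleGraph (Fin n)) (k : ℕ) : ℕ :=
  sSup {m | ∃ B : Fin k → Finset (Fin n),
    (∀ i j, i ≠ j → Disjoint (B i) (B j)) ∧
    (∀ i, IsIndepFinset G (B i)) ∧ m = ∑ i, (B i).card}

/-- `ω_k(G)`: the maximum number of vertices in a clique partition
with `k` blocks. -/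
def omegaK {n : ℕ} (G : SimpleGraph (Fin n)) (k : ℕ) : ℕ :=
  sSup {m | ∃ B : Fin k → Finset (Fin n),
    (∀ i j, i ≠ j → Disjoint (B i) (B j)) ∧
    (∀ i, IsCliqueFinset G (B i)) ∧ m = ∑ i, (B i).card}

/-- `G` is a natural unit interval graph. -/
def IsNUIG {n : ℕ} (G : SimpleGraph (Fin n)) : Prop :=
  ∀ i j k : Fin n, i < j → j < k → G.Adj i k → G.Adj i j ∧ G.Adj j k

/-- The `q`-integer `[k]_q = 1 + q + ⋯ + q^(k-1)` in `ℤ[q]`. -/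
def qInt (k : ℕ) : Polynomial ℤ := ∑ i ∈ Finset.range k, Polynomial.X ^ i

/-- The `q`-factorial `[k]_q!` in `ℤ[q]`. -/
def qFact : ℕ → Polynomial ℤ
  | 0 => 1
  | k + 1 => qInt (k + 1) * qFact k

end

set_option linter.unusedVariables false
set_option linter.unusedSimpArgs false
set_option linter.unusedSectionVars false

/-! ### Abstract relations -/

section Abstract

variable {K : Type*} [Field K]

/-- The operator relations used to compute words. -/
structure Rels {V : Type*} [AddCommGroup V] [Module K V] (q : K)
    (U D : V →ₗ[K] V) (T : ℕ → V →ₗ[K] V) (Nk : ℕ → Submodule K V) : Prop where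
  hU : ∀ k v, v ∈ Nk k → U v ∈ Nk (k + 1)
  hD : ∀ k v, v ∈ Nk (k + 1) → D v ∈ Nk k
  hT : ∀ i k v, v ∈ Nk k → T i v ∈ Nk k
  r1 : ∀ i k v, i + 2 ≤ k → v ∈ Nk k → T i (U v) = U (T i v)
  r2 : ∀ i k v, i + 3 ≤ k → v ∈ Nk k → D (T (i + 1) v) = T i (D v)
  r3 : ∀ k v, v ∈ Nk k → T k (U (U v)) = q • U (U v)
  r4 : ∀ k v, v ∈ Nk (k + 1) →
    T k (U (D (U v) - U (D v))) = D (U (U v)) - U (D (U v))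
  r6 : ∀ k v, v ∈ Nk (k + 2) →
    D (D (U v) - U (D v)) = D (U (D (T 0 v))) - U (D (D (T 0 v)))
  rq : ∀ i k v, i + 2 ≤ k → v ∈ Nk k → T i (T i v) = (q - 1) • T i v + q • v

namespace Rels

variable {V : Type*} [AddCommGroup V] [Module K V] {q : K}
  {U D : V →ₗ[K] V} {T : ℕ → V →ₗ[K] V} {Nk : ℕ → Submodule K V}

/-- The commutator. -/
def phi (U D : V →ₗ[K] V) : V →ₗ[K] V := D ∘ₗ U - U ∘ₗ D

lemma phi_apply (v : V) : phi U D v = D (U v) - U (D v) := rfl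


lemma hphi (h : Rels q U D T Nk) (k : ℕ) (v : V) (hv : v ∈ Nk (k + 1)) : phi U D v ∈ Nk (k + 1) :=
  Submodule.sub_mem _ (h.hD _ _ (h.hU _ _ hv)) (h.hU _ _ (h.hD _ _ hv))

lemma T_phi (h : Rels q U D T Nk) (i k : ℕ) (v : V) (hi : i + 3 ≤ k) (hv : v ∈ Nk k) :
    T i (phi U D v) = phi U D (T (i + 1) v) := by
  obtain ⟨k, rfl⟩ : ∃ j, k = j + 1 := ⟨k - 1, by omega⟩
  rw [phi_apply, phi_apply, map_sub, ← h.r2 i (k + 2) _ (by omega) (h.hU _ _ hv),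
    h.r1 (i + 1) (k + 1) v (by omega) hv, h.r1 i k _ (by omega) (h.hD _ _ hv),
    ← h.r2 i (k + 1) v hi hv]

lemma T_U_phi (h : Rels q U D T Nk) (k : ℕ) (v : V) (hv : v ∈ Nk (k + 1)) :
    T k (U (phi U D v)) = phi U D (U v) := h.r4 k v hv

lemma D_phi (h : Rels q U D T Nk) (k : ℕ) (v : V) (hv : v ∈ Nk (k + 2)) :
    D (phi U D v) = phi U D (D (T 0 v)) := h.r6 k v hv

lemma T_phi_U (h : Rels q U D T Nk) (k : ℕ) (v : V) (hv : v ∈ Nk (k + 1)) :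
    T k (phi U D (U v)) = (q - 1) • phi U D (U v) + q • U (phi U D v) := by
  have h2 := h.rq k (k + 2) (U (phi U D v)) le_rfl (h.hU _ _ (h.hphi _ _ hv))
  rwa [h.T_U_phi k v hv] at h2

lemma T_phi_phi (h : Rels q U D T Nk) (k : ℕ) (v : V) (hv : v ∈ Nk (k + 2)) :
    T k (phi U D (phi U D v)) = phi U D (phi U D (T 0 v)) := by
  have hTv := h.hT 0 _ _ hv
  have a1 : phi U D (D (U (T 0 v))) = T k (D (U (phi U D v))) := by
    rw [← h.r1 0 (k + 2) v (by omega) hv, ← h.D_phi (k + 1) (U v) (h.hU _ _ hv),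
      ← h.T_U_phi (k + 1) v hv,
      h.r2 k (k + 3) _ (by omega) (h.hU _ _ (h.hphi _ _ hv))]
  have a2 : phi U D (U (D (T 0 v))) = T k (U (D (phi U D v))) := by
    rw [h.D_phi k v hv, h.T_U_phi k _ (h.hD _ _ hTv)]
  conv_rhs => rw [phi_apply (T 0 v), map_sub, a1, a2, ← map_sub]
  rfl

end Rels

/-- Words in `U` and the commutator applied to `v0`. -/
inductive Wrd {V : Type*} [AddCommGroup V] [Module K V] (U D : V →ₗ[K] V) (v0 : V) :
    ℕ → ℕ → V → Prop
  | base : Wrd U D v0 0 0 v0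
  | stepU (n k : ℕ) (v : V) : Wrd U D v0 n k v → Wrd U D v0 (n + 1) (k + 1) (U v)
  | stepP (n k : ℕ) (v : V) : Wrd U D v0 n (k + 1) v →
      Wrd U D v0 (n + 1) (k + 1) (Rels.phi U D v)

namespace Wrd

variable {V : Type*} [AddCommGroup V] [Module K V] {q : K}
  {U D : V →ₗ[K] V} {T : ℕ → V →ₗ[K] V} {Nk : ℕ → Submodule K V} {v0 : V}

/-- Span of words of given length and level. -/
def Sp (U D : V →ₗ[K] V) (v0 : V) (n k : ℕ) : Submodule K V :=
  Submodule.span K {v | Wrd U D v0 n k v}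

/-- Span of words of given level. -/
def Ga (U D : V →ₗ[K] V) (v0 : V) (k : ℕ) : Submodule K V :=
  Submodule.span K {v | ∃ n, Wrd U D v0 n k v}

lemma mem_Nk (h : Rels q U D T Nk) (h0 : v0 ∈ Nk 0) {n k : ℕ} {v : V}
    (w : Wrd U D v0 n k v) : v ∈ Nk k := by
  induction w with
  | base => exact h0
  | stepU n k v _ ih => exact h.hU _ _ ih
  | stepP n k v _ ih => exact h.hphi _ _ ih

lemma Sp_le_Nk (h : Rels q U D T Nk) (h0 : v0 ∈ Nk 0) (n k : ℕ) : Sp U D v0 n k ≤ Nk k :=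
  Submodule.span_le.2 fun _ w => mem_Nk h h0 w

lemma Sp_le_Ga (n k : ℕ) : Sp U D v0 n k ≤ Ga U D v0 k :=
  Submodule.span_mono fun _ w => ⟨n, w⟩

lemma U_Sp {n k : ℕ} {v : V} (hv : v ∈ Sp U D v0 n k) : U v ∈ Sp U D v0 (n + 1) (k + 1) := by
  have : Sp U D v0 n k ≤ (Sp U D v0 (n + 1) (k + 1)).comap U :=
    Submodule.span_le.2 fun x w => Submodule.subset_span (Wrd.stepU _ _ _ w)
  exact this hv

lemma phi_Sp {n k : ℕ} {v : V} (hv : v ∈ Sp U D v0 n (k + 1)) :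
    Rels.phi U D v ∈ Sp U D v0 (n + 1) (k + 1) := by
  have : Sp U D v0 n (k + 1) ≤ (Sp U D v0 (n + 1) (k + 1)).comap (Rels.phi U D) :=
    Submodule.span_le.2 fun x w => Submodule.subset_span (Wrd.stepP _ _ _ w)
  exact this hv

lemma U_Ga {k : ℕ} {v : V} (hv : v ∈ Ga U D v0 k) : U v ∈ Ga U D v0 (k + 1) := by
  have : Ga U D v0 k ≤ (Ga U D v0 (k + 1)).comap U :=
    Submodule.span_le.2 fun x ⟨n, w⟩ => Submodule.subset_span ⟨_, Wrd.stepU _ _ _ w⟩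
  exact this hv

lemma phi_Ga {k : ℕ} {v : V} (hv : v ∈ Ga U D v0 (k + 1)) :
    Rels.phi U D v ∈ Ga U D v0 (k + 1) := by
  have : Ga U D v0 (k + 1) ≤ (Ga U D v0 (k + 1)).comap (Rels.phi U D) :=
    Submodule.span_le.2 fun x ⟨n, w⟩ => Submodule.subset_span ⟨_, Wrd.stepP _ _ _ w⟩
  exact this hv

lemma T_Sp (h : Rels q U D T Nk) (h0 : v0 ∈ Nk 0) (n : ℕ) :
    ∀ k i v, i + 2 ≤ k → v ∈ Sp U D v0 n k → T i v ∈ Sp U D v0 n k := by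
  induction n using Nat.strong_induction_on with
  | _ n ih =>
  intro k i v hik hv
  suffices hs : Sp U D v0 n k ≤ (Sp U D v0 n k).comap (T i) from hs hv
  refine Submodule.span_le.2 fun x w => ?_
  change T i x ∈ Sp U D v0 n k
  cases w with
  | base => omega
  | stepU n k w hw =>
    have hw' := Submodule.subset_span (R := K) hw
    have hwN := mem_Nk h h0 hw
    by_cases hc : i + 2 ≤ k
    · rw [h.r1 i k w hc hwN]
      exact U_Sp (ih n (by omega) k i w hc hw')
    · obtain rfl : k = i + 1 := by omega
      cases hw with
      | stepU n _ y hy =>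
        rw [h.r3 i y (mem_Nk h h0 hy)]
        exact Submodule.smul_mem _ _ (U_Sp hw')
      | stepP n _ y hy =>
        rw [h.T_U_phi i y (mem_Nk h h0 hy)]
        exact phi_Sp (U_Sp (Submodule.subset_span hy))
  | stepP n k w hw =>
    have hw' := Submodule.subset_span (R := K) hw
    have hwN := mem_Nk h h0 hw
    by_cases hc : i + 3 ≤ k + 1
    · rw [h.T_phi i (k + 1) w hc hwN]
      exact phi_Sp (ih n (by omega) _ _ w (by omega) hw')
    · obtain rfl : k = i + 1 := by omega
      cases hw with
      | stepU n _ y hy =>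
        rw [h.T_phi_U i y (mem_Nk h h0 hy)]
        exact Submodule.add_mem _ (Submodule.smul_mem _ _ (phi_Sp hw'))
          (Submodule.smul_mem _ _ (U_Sp (phi_Sp (Submodule.subset_span hy))))
      | stepP n _ y hy =>
        rw [h.T_phi_phi i y (mem_Nk h h0 hy)]
        exact phi_Sp (phi_Sp (ih n (by omega) _ _ y (by omega) (Submodule.subset_span hy)))

lemma level_zero {n : ℕ} {v : V} (w : Wrd U D v0 n 0 v) : v = v0 := by
  cases w; rfl

lemma Ga_zero {v : V} (hv : v ∈ Ga U D v0 0) : ∃ a : K, v = a • v0 := by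
  have : Ga U D v0 0 ≤ Submodule.span K {v0} :=
    Submodule.span_mono fun x ⟨n, w⟩ => level_zero w
  obtain ⟨a, ha⟩ := Submodule.mem_span_singleton.1 (this hv)
  exact ⟨a, ha.symm⟩

lemma level_one (θ : ℕ → V) (e : ℕ → K) (hθU : U v0 = θ 0)
    (hθP : ∀ c, Rels.phi U D (θ c) = θ (c + 1) - e c • θ 0) {n k : ℕ} {v : V}
    (w : Wrd U D v0 n k v) (hk : k = 1) : v ∈ Submodule.span K (Set.range θ) := by
  induction w with
  | base => omega
  | stepU n k v hw _ =>
    obtain rfl : k = 0 := by omega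
    rw [level_zero hw, hθU]
    exact Submodule.subset_span ⟨0, rfl⟩
  | stepP n k v _ ih =>
    have hs : Submodule.span K (Set.range θ) ≤
        (Submodule.span K (Set.range θ)).comap (Rels.phi U D) := by
      refine Submodule.span_le.2 ?_
      rintro _ ⟨c, rfl⟩
      change Rels.phi U D (θ c) ∈ Submodule.span K (Set.range θ)
      rw [hθP]
      exact Submodule.sub_mem _ (Submodule.subset_span ⟨_, rfl⟩)
        (Submodule.smul_mem _ _ (Submodule.subset_span ⟨_, rfl⟩))
    exact hs (ih hk)

lemma D_Sp (h : Rels q U D T Nk) (h0 : v0 ∈ Nk 0)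
    (θ : ℕ → V) (e e' : ℕ → K) (hθU : U v0 = θ 0)
    (hθP : ∀ c, Rels.phi U D (θ c) = θ (c + 1) - e c • θ 0)
    (hθD : ∀ c, D (θ c) = e' c • v0) (n : ℕ) :
    ∀ k v, v ∈ Sp U D v0 n (k + 1) → D v ∈ Ga U D v0 k := by
  have hv0 : v0 ∈ Ga U D v0 0 := Submodule.subset_span ⟨0, Wrd.base⟩
  have hone : ∀ n v, Wrd U D v0 n 1 v → D v ∈ Ga U D v0 0 := by
    intro n v w
    have hs : Submodule.span K (Set.range θ) ≤ (Ga U D v0 0).comap D := by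
      refine Submodule.span_le.2 ?_
      rintro _ ⟨c, rfl⟩
      change D (θ c) ∈ Ga U D v0 0
      rw [hθD]
      exact Submodule.smul_mem _ _ hv0
    exact hs (level_one θ e hθU hθP w rfl)
  induction n with
  | zero =>
    intro k v hv
    have hs : Sp U D v0 0 (k + 1) ≤ (Ga U D v0 k).comap D :=
      Submodule.span_le.2 fun x w => by cases w
    exact hs hv
  | succ n ih =>
    intro k v hv
    suffices hs : Sp U D v0 (n + 1) (k + 1) ≤ (Ga U D v0 k).comap D from hs hv
    refine Submodule.span_le.2 fun x w => ?_
    change D x ∈ Ga U D v0 k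
    cases k with
    | zero => exact hone _ _ w
    | succ k =>
      cases w with
      | stepU _ _ w hw =>
        have e1 : D (U w) = U (D w) + Rels.phi U D w := by rw [Rels.phi_apply]; abel
        rw [e1]
        exact Submodule.add_mem _ (U_Ga (ih _ _ (Submodule.subset_span hw)))
          (phi_Ga (Sp_le_Ga _ _ (Submodule.subset_span hw)))
      | stepP _ _ w hw =>
        rw [h.D_phi k w (mem_Nk h h0 hw)]
        have hw' := Submodule.subset_span (R := K) hw
        exact phi_Ga (ih _ _ (T_Sp h h0 n _ 0 w (by omega) hw'))

lemma D_Ga (h : Rels q U D T Nk) (h0 : v0 ∈ Nk 0)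
    (θ : ℕ → V) (e e' : ℕ → K) (hθU : U v0 = θ 0)
    (hθP : ∀ c, Rels.phi U D (θ c) = θ (c + 1) - e c • θ 0)
    (hθD : ∀ c, D (θ c) = e' c • v0) (k : ℕ) (v : V) (hv : v ∈ Ga U D v0 (k + 1)) :
    D v ∈ Ga U D v0 k := by
  suffices hs : Ga U D v0 (k + 1) ≤ (Ga U D v0 k).comap D from hs hv
  refine Submodule.span_le.2 fun x ⟨n, w⟩ => ?_
  exact D_Sp h h0 θ e e' hθU hθP hθD n k x (Submodule.subset_span w)

end Wrd

lemma Rels.prod {V W : Type*} [AddCommGroup V] [Module K V] [AddCommGroup W] [Module K W] {q : K}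
    {U D : V →ₗ[K] V} {T : ℕ → V →ₗ[K] V} {Nk : ℕ → Submodule K V}
    {U' D' : W →ₗ[K] W} {T' : ℕ → W →ₗ[K] W} {Nk' : ℕ → Submodule K W}
    (h : Rels q U D T Nk) (h' : Rels q U' D' T' Nk') :
    Rels q (U.prodMap U') (D.prodMap D') (fun i => (T i).prodMap (T' i))
      (fun k => (Nk k).prod (Nk' k)) where
  hU k v hv := ⟨h.hU k _ hv.1, h'.hU k _ hv.2⟩
  hD k v hv := ⟨h.hD k _ hv.1, h'.hD k _ hv.2⟩
  hT i k v hv := ⟨h.hT i k _ hv.1, h'.hT i k _ hv.2⟩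
  r1 i k v hi hv := Prod.ext (h.r1 i k _ hi hv.1) (h'.r1 i k _ hi hv.2)
  r2 i k v hi hv := Prod.ext (h.r2 i k _ hi hv.1) (h'.r2 i k _ hi hv.2)
  r3 k v hv := Prod.ext (h.r3 k _ hv.1) (h'.r3 k _ hv.2)
  r4 k v hv := Prod.ext (h.r4 k _ hv.1) (h'.r4 k _ hv.2)
  r6 k v hv := Prod.ext (h.r6 k _ hv.1) (h'.r6 k _ hv.2)
  rq i k v hi hv := Prod.ext (h.rq i k _ hi hv.1) (h'.rq i k _ hi hv.2)

end Abstract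


/-! ### Systems with labels -/

section LabelSystems

variable {K : Type*} [Field K] {L : Type*} [Fintype L]

/-- Pointwise identities for a labelled system. -/
structure LabSys (q : K) (ω : List L → L → K) (A B : L → L → K) : Prop where
  perm : ∀ l l' c, l.Perm l' → ω l c = ω l' c
  mem : ∀ l c, c ∈ l → ω l c = 0
  quad1 : ∀ x y, x ≠ y → A x y * A x y + B x y * B y x = (q - 1) * A x y + q
  quad2 : ∀ x y, x ≠ y → A x y + A y x = q - 1
  i3 : ∀ l z w, l.Nodup → z ∉ l → w ∉ l → z ≠ w →
    A z w * (ω l z * ω (z :: l) w) + B z w * (ω l w * ω (w :: l) z) = q * (ω l z * ω (z :: l) w)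
  i4 : ∀ l y z w, l.Nodup → y ∉ l → z ∉ l → w ∉ l → z ≠ w →
    A z w * ((ω (y :: l) z - ω l z) * ω (z :: l) w) +
      B z w * ((ω (y :: l) w - ω l w) * ω (w :: l) z) =
      ω (y :: l) z * (ω (z :: y :: l) w - ω (z :: l) w)
  i6 : ∀ l y y' z, l.Nodup → y ∉ l → y' ∉ l → z ∉ l → y ≠ y' →
    A y y' * (ω (y' :: l) z - ω l z) + B y' y * (ω (y :: l) z - ω l z) =
      ω (y :: y' :: l) z - ω (y' :: l) z

/-- Adding a vertex. -/
def uOp (ω : List L → L → K) : (List L → K) →ₗ[K] (List L → K) where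
  toFun ψ l := match l.getLast? with
    | none => 0
    | some c => ω l.dropLast c * ψ l.dropLast
  map_add' ψ χ := by
    funext l; cases h : l.getLast? <;> simp [h, mul_add]
  map_smul' a ψ := by
    funext l; cases h : l.getLast? <;> simp [h]; ring

/-- Forgetting the oldest active vertex. -/
def dOp : (List L → K) →ₗ[K] (List L → K) where
  toFun ψ l := ∑ c, ψ (c :: l)
  map_add' ψ χ := by
    funext l; simp [Finset.sum_add_distrib]
  map_smul' a ψ := by
    funext l; simp [Finset.mul_sum]

/-- Exchange operators. -/
def tOp (A B : L → L → K) (i : ℕ) : (List L → K) →ₗ[K] (List L → K) where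
  toFun ψ l := match l.drop i with
    | x :: y :: b => A x y * ψ l + B x y * ψ (l.take i ++ y :: x :: b)
    | _ => 0
  map_add' ψ χ := by
    funext l
    rcases h : l.drop i with _ | ⟨x, _ | ⟨y, b⟩⟩ <;> simp [h]; ring
  map_smul' a ψ := by
    funext l
    rcases h : l.drop i with _ | ⟨x, _ | ⟨y, b⟩⟩ <;> simp [h]; ring

/-- Functions supported on duplicate-free lists of length `k`. -/
def nSub (K L : Type*) [Field K] (k : ℕ) : Submodule K (List L → K) where
  carrier := {ψ | ∀ l, ¬ (l.length = k ∧ l.Nodup) → ψ l = 0}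
  add_mem' := by
    intro a b ha hb l hl
    simp [ha l hl, hb l hl]
  zero_mem' := by intro l _; rfl
  smul_mem' := by
    intro c a ha l hl
    simp [ha l hl]

lemma mem_nSub {k : ℕ} {ψ : List L → K} :
    ψ ∈ nSub K L k ↔ ∀ l, ¬ (l.length = k ∧ l.Nodup) → ψ l = 0 := Iff.rfl

lemma nSub_ext {k : ℕ} {ψ χ : List L → K} (h1 : ψ ∈ nSub K L k) (h2 : χ ∈ nSub K L k)
    (h : ∀ l : List L, l.length = k → l.Nodup → ψ l = χ l) : ψ = χ := by
  funext l
  by_cases hl : l.length = k ∧ l.Nodup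
  · exact h l hl.1 hl.2
  · rw [h1 l hl, h2 l hl]

@[simp] lemma uOp_nil (ω : List L → L → K) (ψ : List L → K) : uOp ω ψ [] = 0 := rfl

@[simp] lemma uOp_append (ω : List L → L → K) (ψ : List L → K) (l : List L) (c : L) :
    uOp ω ψ (l ++ [c]) = ω l c * ψ l := by
  simp [uOp]

lemma dOp_apply (ψ : List L → K) (l : List L) : dOp ψ l = ∑ c, ψ (c :: l) := rfl

lemma tOp_append (A B : L → L → K) (ψ : List L → K) (a b : List L) (x y : L) (i : ℕ)
    (hi : a.length = i) :
    tOp A B i ψ (a ++ x :: y :: b) =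
      A x y * ψ (a ++ x :: y :: b) + B x y * ψ (a ++ y :: x :: b) := by
  subst hi
  simp [tOp]

lemma exists_split (l : List L) (i : ℕ) (h : i + 2 ≤ l.length) :
    ∃ a x y b, l = a ++ x :: y :: b ∧ a.length = i := by
  refine ⟨l.take i, l[i], l[i + 1], l.drop (i + 2), ?_, by simp; omega⟩
  conv_lhs => rw [← List.take_append_drop i l]
  rw [List.drop_eq_getElem_cons (by omega), List.drop_eq_getElem_cons (by omega)]

lemma exists_snoc (l : List L) (k : ℕ) (h : l.length = k + 1) :
    ∃ a z, l = a ++ [z] ∧ a.length = k := by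
  have hne : l ≠ [] := by rintro rfl; simp at h
  exact ⟨l.dropLast, l.getLast hne, (List.dropLast_append_getLast hne).symm, by simp [h]⟩

variable {q : K} {ω : List L → L → K} {A B : L → L → K}

lemma dOp_mem {k : ℕ} {v : List L → K} (hv : v ∈ nSub K L (k + 1)) : dOp v ∈ nSub K L k := by
  intro l hl
  rw [dOp_apply]
  refine Finset.sum_eq_zero fun c _ => hv _ fun hh => hl ?_
  exact ⟨by simpa using hh.1, (List.nodup_cons.1 hh.2).2⟩

lemma tOp_mem {i k : ℕ} {v : List L → K} (hv : v ∈ nSub K L k) : tOp A B i v ∈ nSub K L k := by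
  intro l hl
  by_cases h : i + 2 ≤ l.length
  · obtain ⟨a, x, y, b, rfl, ha⟩ := exists_split l i h
    rw [tOp_append _ _ _ _ _ _ _ _ ha, hv _ hl, hv _, mul_zero, mul_zero, add_zero]
    intro hh
    apply hl
    have hp : (a ++ y :: x :: b).Perm (a ++ x :: y :: b) :=
      List.Perm.append_left a (List.Perm.swap _ _ _)
    exact ⟨by rw [← hp.length_eq]; exact hh.1, hp.nodup_iff.1 hh.2⟩
  · have hd : (l.drop i).length < 2 := by simp; omega
    rcases hh : l.drop i with _ | ⟨x, _ | ⟨y, b⟩⟩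
    · simp [tOp, hh]
    · simp [tOp, hh]
    · simp [hh] at hd


lemma LabSys.uOp_mem (h : LabSys q ω A B) {k : ℕ} {v : List L → K} (hv : v ∈ nSub K L k) :
    uOp ω v ∈ nSub K L (k + 1) := by
  intro l hl
  rcases List.eq_nil_or_concat l with rfl | ⟨a, z, rfl⟩
  · rfl
  · rw [List.concat_eq_append] at hl ⊢
    rw [uOp_append]
    by_cases hz : z ∈ a
    · rw [h.mem _ _ hz, zero_mul]
    · rw [hv a, mul_zero]
      intro hh
      apply hl
      refine ⟨by simp [hh.1], ?_⟩
      rw [← List.concat_eq_append, List.nodup_concat]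
      exact ⟨hz, hh.2⟩

lemma LabSys.rels (h : LabSys q ω A B) : Rels q (uOp ω) dOp (tOp A B) (nSub K L) where
  hU k v hv := h.uOp_mem hv
  hD k v hv := dOp_mem hv
  hT i k v hv := tOp_mem hv
  r1 i k v hi hv := by
    refine nSub_ext (tOp_mem (h.uOp_mem hv)) (h.uOp_mem (tOp_mem hv)) fun l hl hn => ?_
    obtain ⟨l, z, rfl, hl'⟩ := exists_snoc l k hl
    obtain ⟨a, x, y, b, rfl, ha⟩ := exists_split l i (by omega)
    rw [uOp_append, tOp_append _ _ _ _ _ _ _ _ ha, List.append_assoc, List.cons_append,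
      List.cons_append, tOp_append _ _ _ _ _ _ _ _ ha]
    have e1 : ∀ x y : L, a ++ x :: y :: (b ++ [z]) = (a ++ x :: y :: b) ++ [z] := by simp
    rw [e1, e1, uOp_append, uOp_append,
      h.perm (a ++ y :: x :: b) (a ++ x :: y :: b) z
        (List.Perm.append_left a (List.Perm.swap _ _ _))]
    ring
  r2 i k v hi hv := by
    obtain ⟨k, rfl⟩ : ∃ j, k = j + 1 := ⟨k - 1, by omega⟩
    refine nSub_ext (dOp_mem (tOp_mem hv)) (tOp_mem (dOp_mem hv)) fun l hl hn => ?_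
    obtain ⟨a, x, y, b, rfl, ha⟩ := exists_split l i (by omega)
    rw [tOp_append _ _ _ _ _ _ _ _ ha, dOp_apply, dOp_apply, dOp_apply, Finset.mul_sum,
      Finset.mul_sum, ← Finset.sum_add_distrib]
    refine Finset.sum_congr rfl fun c _ => ?_
    rw [← List.cons_append, tOp_append _ _ _ (c :: a) _ _ _ _ (by simp [ha])]
    simp
  r3 k v hv := by
    refine nSub_ext (tOp_mem (h.uOp_mem (h.uOp_mem hv)))
      (Submodule.smul_mem _ _ (h.uOp_mem (h.uOp_mem hv))) fun l hl hn => ?_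
    obtain ⟨l, w, rfl, hl'⟩ := exists_snoc l (k + 1) hl
    obtain ⟨l, z, rfl, hl''⟩ := exists_snoc l k hl'
    have e1 : ∀ z w : L, l ++ [z] ++ [w] = l ++ z :: w :: [] := by simp
    have e2 : ∀ z w : L, ω (l ++ [z]) w = ω (z :: l) w := fun z w =>
      h.perm _ _ _ (List.perm_append_singleton z l)
    rw [e1] at hn
    rw [e1, tOp_append _ _ _ _ _ _ _ _ hl'', Pi.smul_apply, ← e1, ← e1]
    simp only [uOp_append, e2, smul_eq_mul]
    rw [List.nodup_append] at hn
    have h1 : z ∉ l := fun hz => hn.2.2 z hz z (by simp) rfl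
    have h2 : w ∉ l := fun hz => hn.2.2 w hz w (by simp) rfl
    have h3 : z ≠ w := by
      have := hn.2.1; simp at this; exact this
    have := h.i3 l z w hn.1 h1 h2 h3
    linear_combination v l * this
  r4 k v hv := by
    have hUv := h.uOp_mem hv
    have hUUv := h.uOp_mem hUv
    refine nSub_ext (k := k + 2) (tOp_mem (h.uOp_mem (Submodule.sub_mem _ (dOp_mem hUv)
        (h.uOp_mem (dOp_mem hv))))) (Submodule.sub_mem _ (dOp_mem hUUv)
      (h.uOp_mem (dOp_mem hUv))) fun l hl hn => ?_
    obtain ⟨l, w, rfl, hl'⟩ := exists_snoc l (k + 1) hl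
    obtain ⟨l, z, rfl, hl''⟩ := exists_snoc l k hl'
    have e1 : ∀ z w : L, l ++ [z] ++ [w] = l ++ z :: w :: [] := by simp
    have e2 : ∀ z w : L, ω (l ++ [z]) w = ω (z :: l) w := fun z w =>
      h.perm _ _ _ (List.perm_append_singleton z l)
    have e3 : ∀ y z w : L, ω (y :: (l ++ [z])) w = ω (z :: y :: l) w := fun y z w =>
      h.perm _ _ _ (List.perm_append_singleton z (y :: l))
    rw [e1] at hn
    rw [e1, tOp_append _ _ _ _ _ _ _ _ hl'', Pi.sub_apply, ← e1, ← e1]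
    simp only [uOp_append, Pi.sub_apply, dOp_apply, ← List.cons_append, smul_eq_mul, e2]
    rw [List.nodup_append] at hn
    have h1 : z ∉ l := fun hz => hn.2.2 z hz z (by simp) rfl
    have h2 : w ∉ l := fun hz => hn.2.2 w hz w (by simp) rfl
    have h3 : z ≠ w := by
      have := hn.2.1; simp at this; exact this
    simp only [Finset.mul_sum, ← Finset.sum_sub_distrib, ← Finset.sum_add_distrib]
    refine Finset.sum_congr rfl fun y _ => ?_
    by_cases hy : y ∈ l
    · rw [hv (y :: l) (by simp [hy])]; ring
    · have := h.i4 l y z w hn.1 hy h1 h2 h3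
      simp only [List.cons_append, e3]
      linear_combination v (y :: l) * this
  r6 k v hv := by
    have hTv : tOp A B 0 v ∈ nSub K L (k + 2) := tOp_mem hv
    refine nSub_ext (k := k + 1) (dOp_mem (Submodule.sub_mem _ (dOp_mem (h.uOp_mem hv))
      (h.uOp_mem (dOp_mem hv)))) (Submodule.sub_mem _
      (dOp_mem (h.uOp_mem (dOp_mem hTv))) (h.uOp_mem (dOp_mem (dOp_mem hTv))))
        fun l hl hn => ?_
    obtain ⟨l, z, rfl, hl'⟩ := exists_snoc l k hl
    have e4 : ∀ y y' : L, tOp A B 0 v (y :: y' :: l) =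
        A y y' * v (y :: y' :: l) + B y y' * v (y' :: y :: l) := fun y y' =>
      tOp_append A B v [] l y y' 0 rfl
    simp only [Pi.smul_apply, uOp_append, Pi.sub_apply, dOp_apply, ← List.cons_append,
      smul_eq_mul, e4]
    rw [List.nodup_append] at hn
    have h1 : z ∉ l := fun hz => hn.2.2 z hz z (by simp) rfl
    -- rearrange the double sum
    have hL : ∑ c, (∑ d, ω (d :: c :: l) z * v (d :: c :: l) -
        ω (c :: l) z * ∑ d, v (d :: c :: l)) =
        ∑ c, ∑ d, (ω (d :: c :: l) z - ω (c :: l) z) * v (d :: c :: l) := by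
      simp only [Finset.mul_sum, ← Finset.sum_sub_distrib]
      exact Finset.sum_congr rfl fun c _ => Finset.sum_congr rfl fun d _ => by ring
    have hR : ∑ c, ω (c :: l) z * ∑ d, (A d c * v (d :: c :: l) + B d c * v (c :: d :: l)) -
        ω l z * ∑ c, ∑ d, (A d c * v (d :: c :: l) + B d c * v (c :: d :: l)) =
        ∑ c, ∑ d, (A d c * (ω (c :: l) z - ω l z) +
          B c d * (ω (d :: l) z - ω l z)) * v (d :: c :: l) := by
      have h5 : ∑ c, ∑ d, B c d * (ω (d :: l) z - ω l z) * v (d :: c :: l) =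
          ∑ c, ∑ d, B d c * (ω (c :: l) z - ω l z) * v (c :: d :: l) :=
        Finset.sum_comm
      simp only [add_mul, Finset.sum_add_distrib, h5]
      simp only [Finset.mul_sum, ← Finset.sum_sub_distrib, ← Finset.sum_add_distrib]
      exact Finset.sum_congr rfl fun c _ => Finset.sum_congr rfl fun d _ => by ring
    refine hL.trans (Eq.trans ?_ hR.symm)
    refine Finset.sum_congr rfl fun c _ => Finset.sum_congr rfl fun d _ => ?_
    by_cases hcd : (d :: c :: l).Nodup
    · simp only [List.nodup_cons, List.mem_cons, not_or] at hcd
      rw [h.i6 l d c z hcd.2.2 hcd.1.2 hcd.2.1 h1 hcd.1.1]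
    · rw [hv (d :: c :: l) (fun hh => hcd hh.2)]; ring
  rq i k v hi hv := by
    refine nSub_ext (tOp_mem (tOp_mem hv)) (Submodule.add_mem _ (Submodule.smul_mem _ _
      (tOp_mem hv)) (Submodule.smul_mem _ _ hv)) fun l hl hn => ?_
    obtain ⟨a, x, y, b, rfl, ha⟩ := exists_split l i (by omega)
    have hxy : x ≠ y := by
      have := (List.nodup_append.1 hn).2.1
      simp at this
      tauto
    simp only [tOp_append _ _ _ _ _ _ _ _ ha, Pi.add_apply, Pi.smul_apply, smul_eq_mul]
    have q1 := h.quad1 x y hxy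
    have q2 := h.quad2 x y hxy
    linear_combination v (a ++ x :: y :: b) * q1 + B x y * v (a ++ y :: x :: b) * q2

end LabelSystems


/-! ### Comparing two labelled systems -/

section Compare

variable {K : Type*} [Field K] {L : Type*} [Fintype L]

/-- Backward evaluation of a word; `d` counts the vertices forgotten before each new vertex. -/
def bval (ω : List L → L → K) : List ℕ → List L → K
  | [], _ => 1
  | d :: ds, l => ∑ c, ω (l.drop d) c * bval ω ds (l.drop d ++ [c])

/-- A word never forgets more than what is active. -/
def legal : ℕ → List ℕ → Prop
  | _, [] => True
  | k, d :: ds => d ≤ k ∧ legal (k - d + 1) ds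

/-- Total mass of a function on lists of length `k`. -/
def tot : ℕ → (List L → K) →ₗ[K] K
  | 0 => LinearMap.proj []
  | k + 1 => tot k ∘ₗ dOp

lemma tot_succ (k : ℕ) (ψ : List L → K) : tot (k + 1) ψ = tot k (dOp ψ) := rfl

lemma tot_drop (d : ℕ) : ∀ (k : ℕ) (ψ f : List L → K),
    tot k ((dOp^[d] ψ) * f) = tot (k + d) (ψ * fun l => f (l.drop d)) := by
  induction d with
  | zero => intro k ψ f; rfl
  | succ d ih =>
    intro k ψ f
    rw [Function.iterate_succ_apply, ih k (dOp ψ) f, ← Nat.add_assoc, tot_succ]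
    congr 1
    funext l
    simp [dOp_apply, Finset.sum_mul]

lemma tot_snoc (k : ℕ) : ∀ (χ : List L → K),
    tot (k + 1) χ = ∑ c, tot k (fun l => χ (l ++ [c])) := by
  induction k with
  | zero => intro χ; rfl
  | succ k ih =>
    intro χ
    rw [tot_succ, ih]
    refine Finset.sum_congr rfl fun c _ => ?_
    rw [tot_succ]
    rfl

lemma tot_uOp (ω : List L → L → K) (k : ℕ) (ψ f : List L → K) :
    tot (k + 1) (uOp ω ψ * f) = tot k (ψ * fun l => ∑ c, ω l c * f (l ++ [c])) := by
  rw [tot_snoc, ← map_sum]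
  congr 1
  funext l
  simp only [Finset.sum_apply, Pi.mul_apply, uOp_append, Finset.mul_sum]
  exact Finset.sum_congr rfl fun c _ => by ring

/-- Forward evaluation of a word. -/
def runW {V : Type*} [AddCommGroup V] [Module K V] (U D : V →ₗ[K] V) : List ℕ → V → V
  | [], v => v
  | d :: ds, v => runW U D ds (U (D^[d] v))

/-- Number of active vertices at the end. -/
def finLen : ℕ → List ℕ → ℕ
  | k, [] => k
  | k, d :: ds => finLen (k - d + 1) ds

lemma tot_run (ω : List L → L → K) (ds : List ℕ) : ∀ (k : ℕ) (ψ : List L → K), legal k ds →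
    tot (finLen k ds) (runW (uOp ω) dOp ds ψ) = tot k (ψ * bval ω ds) := by
  induction ds with
  | nil =>
    intro k ψ _
    change tot k ψ = tot k _
    congr 1
    funext l
    simp [bval]
  | cons d ds ih =>
    intro k ψ hk
    change tot (finLen (k - d + 1) ds) (runW (uOp ω) dOp ds _) = _
    rw [ih _ _ hk.2, tot_uOp, tot_drop, Nat.sub_add_cancel hk.1]
    rfl

lemma prod_iter {V W : Type*} [AddCommGroup V] [Module K V] [AddCommGroup W] [Module K W]
    (D : V →ₗ[K] V) (D' : W →ₗ[K] W) (d : ℕ) : ∀ v : V × W,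
    (D.prodMap D')^[d] v = (D^[d] v.1, D'^[d] v.2) := by
  induction d with
  | zero => intro v; rfl
  | succ d ih => intro v; rw [Function.iterate_succ_apply, ih]; rfl

lemma prod_run {V W : Type*} [AddCommGroup V] [Module K V] [AddCommGroup W] [Module K W]
    (U D : V →ₗ[K] V) (U' D' : W →ₗ[K] W) (ds : List ℕ) : ∀ v : V × W,
    runW (U.prodMap U') (D.prodMap D') ds v = (runW U D ds v.1, runW U' D' ds v.2) := by
  induction ds with
  | nil => intro v; rfl
  | cons d ds ih =>
    intro v
    change runW _ _ ds (_) = _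
    rw [ih, prod_iter]
    rfl

/-- The vacuum. -/
noncomputable def vac (K L : Type*) [Field K] : List L → K := fun l => if l = [] then 1 else 0

lemma vac_mem : vac K L ∈ nSub K L 0 := by
  intro l hl
  have : l ≠ [] := by rintro rfl; simp at hl
  simp [vac, this]

theorem bval_eq_bval {q : K} {ω ω' : List L → L → K} {A B A' B' : L → L → K}
    (h : LabSys q ω A B) (h' : LabSys q ω' A' B')
    (θ θ' : ℕ → List L → K) (e e' : ℕ → K)
    (hU : uOp ω (vac K L) = θ 0) (hU' : uOp ω' (vac K L) = θ' 0)
    (hP : ∀ c, Rels.phi (uOp ω) dOp (θ c) = θ (c + 1) - e c • θ 0)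
    (hP' : ∀ c, Rels.phi (uOp ω') dOp (θ' c) = θ' (c + 1) - e c • θ' 0)
    (hD : ∀ c, dOp (θ c) = e' c • vac K L)
    (hD' : ∀ c, dOp (θ' c) = e' c • vac K L)
    (ds : List ℕ) (hds : legal 0 ds) : bval ω ds [] = bval ω' ds [] := by
  set UU := (uOp ω).prodMap (uOp ω') with hUU
  set DD := (dOp (K := K) (L := L)).prodMap (dOp (K := K) (L := L)) with hDD
  have hR := h.rels.prod h'.rels
  set v0 : (List L → K) × (List L → K) := (vac K L, vac K L) with hv0
  have hD_Ga : ∀ k v, v ∈ Wrd.Ga UU DD v0 (k + 1) → DD v ∈ Wrd.Ga UU DD v0 k := by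
    refine Wrd.D_Ga hR ⟨vac_mem, vac_mem⟩ (fun c => (θ c, θ' c)) e e' ?_ ?_ ?_
    · exact Prod.ext hU hU'
    · intro c
      exact Prod.ext (hP c) (hP' c)
    · intro c
      exact Prod.ext (hD c) (hD' c)
  have hD_iter : ∀ d k v, d ≤ k → v ∈ Wrd.Ga UU DD v0 k → DD^[d] v ∈ Wrd.Ga UU DD v0 (k - d) := by
    intro d
    induction d with
    | zero => intro k v _ hv; exact hv
    | succ d ih =>
      intro k v hd hv
      obtain ⟨k, rfl⟩ : ∃ j, k = j + 1 := ⟨k - 1, by omega⟩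
      rw [Function.iterate_succ_apply, Nat.add_sub_add_right]
      exact ih k _ (by omega) (hD_Ga _ _ hv)
  have hrun : ∀ ds k v, legal k ds → v ∈ Wrd.Ga UU DD v0 k →
      runW UU DD ds v ∈ Wrd.Ga UU DD v0 (finLen k ds) := by
    intro ds
    induction ds with
    | nil => intro k v _ hv; exact hv
    | cons d ds ih =>
      intro k v hk hv
      exact ih _ _ hk.2 (Wrd.U_Ga (hD_iter d k v hk.1 hv))
  have htot : ∀ k v, v ∈ Wrd.Ga UU DD v0 k → tot k v.1 = tot k v.2 := by
    intro k
    induction k with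
    | zero =>
      intro v hv
      obtain ⟨a, rfl⟩ := Wrd.Ga_zero hv
      rfl
    | succ k ih => intro v hv; exact ih _ (hD_Ga _ _ hv)
  have hfin := htot _ _ (hrun ds 0 v0 hds (Submodule.subset_span ⟨0, Wrd.base⟩))
  rw [hUU, hDD, prod_run] at hfin
  change tot _ (runW (uOp ω) dOp ds (vac K L)) = tot _ (runW (uOp ω') dOp ds (vac K L)) at hfin
  rw [tot_run _ _ _ _ hds, tot_run _ _ _ _ hds] at hfin
  simpa [tot, vac] using hfin

end Compare


/-! ### Reduction to singletons -/

section Singles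

variable {K : Type*} [Field K] {L : Type*} [Fintype L]

/-- A function supported on one-element lists. -/
def sing (t : L → K) : List L → K
  | [z] => t z
  | _ => 0

lemma uOp_vac (ω : List L → L → K) : uOp ω (vac K L) = sing (ω []) := by
  funext l
  rcases List.eq_nil_or_concat l with rfl | ⟨a, z, rfl⟩
  · rfl
  · rw [List.concat_eq_append, uOp_append]
    rcases a with _ | ⟨b, a⟩
    · simp [vac, sing]
    · rcases a with _ | ⟨b', a⟩ <;> simp [vac, sing]

lemma dOp_sing (t : L → K) : dOp (sing t) = (∑ z, t z) • vac K L := by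
  funext l
  rw [dOp_apply]
  rcases l with _ | ⟨b, a⟩
  · simp [sing, vac]
  · simp [sing, vac]

lemma phi_sing (ω : List L → L → K) (t : L → K) :
    Rels.phi (uOp ω) dOp (sing t) = sing fun z => ∑ y, (ω [y] z - ω [] z) * t y := by
  funext l
  rw [Rels.phi_apply, Pi.sub_apply]
  rcases List.eq_nil_or_concat l with rfl | ⟨a, z, rfl⟩
  · have : ∀ c : L, uOp ω (sing t) [c] = 0 := fun c => by
      have := uOp_append ω (sing t) [] c
      simpa [sing] using this
    simp [dOp_apply, this, sing]
  · rw [List.concat_eq_append, uOp_append, dOp_apply, dOp_apply]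
    simp only [← List.cons_append, uOp_append]
    rcases a with _ | ⟨b, a⟩
    · simp only [sing, List.nil_append, Finset.mul_sum, ← Finset.sum_sub_distrib]
      exact Finset.sum_congr rfl fun c _ => by ring
    · rcases a with _ | ⟨b', a⟩ <;> simp [sing]

lemma sing_sub_smul (t s : L → K) (a : K) :
    sing t - a • sing s = sing fun z => t z - a * s z := by
  funext l
  rcases l with _ | ⟨b, _ | ⟨b', a⟩⟩ <;> simp [sing]

theorem bval_eq_bval' {q : K} {ω ω' : List L → L → K} {A B A' B' : L → L → K}
    (h : LabSys q ω A B) (h' : LabSys q ω' A' B')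
    (t t' : ℕ → L → K) (e e' : ℕ → K)
    (hU : ∀ z, ω [] z = t 0 z) (hU' : ∀ z, ω' [] z = t' 0 z)
    (hP : ∀ c z, ∑ y, (ω [y] z - ω [] z) * t c y = t (c + 1) z - e c * t 0 z)
    (hP' : ∀ c z, ∑ y, (ω' [y] z - ω' [] z) * t' c y = t' (c + 1) z - e c * t' 0 z)
    (hD : ∀ c, ∑ z, t c z = e' c) (hD' : ∀ c, ∑ z, t' c z = e' c)
    (ds : List ℕ) (hds : legal 0 ds) : bval ω ds [] = bval ω' ds [] := by
  refine bval_eq_bval h h' (fun c => sing (t c)) (fun c => sing (t' c)) e e' ?_ ?_ ?_ ?_ ?_ ?_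
    ds hds
  · rw [uOp_vac]; congr 1; funext z; exact hU z
  · rw [uOp_vac]; congr 1; funext z; exact hU' z
  · intro c; rw [phi_sing, sing_sub_smul]; congr 1; funext z; exact hP c z
  · intro c; rw [phi_sing, sing_sub_smul]; congr 1; funext z; exact hP' c z
  · intro c; rw [dOp_sing, hD]
  · intro c; rw [dOp_sing, hD']

end Singles

/-! ### The colouring system -/

section ColourSystem

variable {K : Type*} [Field K] {N : ℕ}

/-- Weight of an edge. -/
noncomputable def fW (q : K) (a b : Fin N) : K := if a = b then 0 else if a < b then q else 1

/-- Weight of a new vertex. -/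
noncomputable def wF (q : K) (x : Fin N → K) (l : List (Fin N)) (c : Fin N) : K :=
  x c * (l.map fun a => fW q a c).prod

lemma wF_nil (q : K) (x : Fin N → K) (c : Fin N) : wF q x [] c = x c := by simp [wF]

lemma wF_cons (q : K) (x : Fin N → K) (y : Fin N) (l : List (Fin N)) (c : Fin N) :
    wF q x (y :: l) c = fW q y c * wF q x l c := by
  simp [wF]; ring

lemma labSysF (q : K) (x : Fin N → K) : LabSys q (wF q x)
    (fun a b => if a < b then q - 1 else 0) (fun a b => if a < b then q else 1) where
  perm l l' c h := by
    unfold wF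
    rw [(h.map _).prod_eq]
  mem l c h := by
    have : (0 : K) ∈ l.map fun a => fW q a c := List.mem_map.2 ⟨c, h, by simp [fW]⟩
    rw [wF, List.prod_eq_zero this, mul_zero]
  quad1 a b hab := by
    rcases lt_or_gt_of_ne hab with h | h <;> simp [h, h.not_gt]
  quad2 a b hab := by
    rcases lt_or_gt_of_ne hab with h | h <;> simp [h, h.not_gt]
  i3 l z w _ _ _ hab := by
    simp only [wF_cons, fW]
    rcases lt_or_gt_of_ne hab with h | h <;> simp [h, h.not_gt, h.ne, h.ne'] <;> ring
  i4 l y z w _ _ _ _ hab := by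
    simp only [wF_cons, fW]
    generalize wF q x l z = Z
    generalize wF q x l w = W
    rcases lt_or_gt_of_ne hab with h | h <;> simp only [h, h.not_gt, h.ne, h.ne', if_true, if_false]
    all_goals
      rcases lt_trichotomy y z with h1 | h1 | h1
      all_goals
        rcases lt_trichotomy y w with h2 | h2 | h2
      all_goals
        first
        | (exfalso; order)
        | (subst h1; simp [h, h2, h.not_gt, h.ne, h.ne', h2.ne, h2.ne', h2.not_gt]; try ring)
        | (subst h2; simp [h, h1, h.not_gt, h.ne, h.ne', h1.ne, h1.ne', h1.not_gt]; try ring)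
        | (simp [h1, h2, h1.ne, h1.ne', h2.ne, h2.ne', h1.not_gt, h2.not_gt]; try ring)
  i6 l y y' z _ _ _ _ hab := by
    simp only [wF_cons, fW]
    generalize wF q x l z = Z
    rcases lt_or_gt_of_ne hab with h | h <;> simp only [h, h.not_gt, h.ne, h.ne', if_true, if_false]
    all_goals
      rcases lt_trichotomy y z with h1 | h1 | h1
      all_goals
        rcases lt_trichotomy y' z with h2 | h2 | h2
      all_goals
        first
        | (exfalso; order)
        | (subst h1; simp [h, h2, h.not_gt, h.ne, h.ne', h2.ne, h2.ne', h2.not_gt]; try ring)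
        | (subst h2; simp [h, h1, h.not_gt, h.ne, h.ne', h1.ne, h1.ne', h1.not_gt]; try ring)
        | (simp [h1, h2, h1.ne, h1.ne', h2.ne, h2.ne', h1.not_gt, h2.not_gt]; try ring)

/-- Generating polynomial with the first `m` variables scaled. -/
noncomputable def genH (q : K) (x : Fin N → K) (m : ℕ) : Polynomial K :=
  ∏ a : Fin N, if a.val < m then (1 + Polynomial.C (q * x a) * Polynomial.X) else (1 + Polynomial.C (x a) * Polynomial.X)

/-- The same with the variable `z` removed. -/
noncomputable def genE (q : K) (x : Fin N → K) (z : Fin N) : Polynomial K :=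
  ∏ a ∈ Finset.univ.erase z, if a < z then (1 + Polynomial.C (q * x a) * Polynomial.X) else (1 + Polynomial.C (x a) * Polynomial.X)

lemma genH_eq (q : K) (x : Fin N → K) (z : Fin N) :
    genH q x z.val = (1 + Polynomial.C (x z) * Polynomial.X) * genE q x z := by
  unfold genH genE
  rw [← Finset.mul_prod_erase Finset.univ _ (Finset.mem_univ z)]
  simp only [lt_self_iff_false, if_false]
  rfl

lemma genH_succ (q : K) (x : Fin N → K) (z : Fin N) :
    genH q x (z.val + 1) = (1 + Polynomial.C (q * x z) * Polynomial.X) * genE q x z := by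
  unfold genH genE
  rw [← Finset.mul_prod_erase Finset.univ _ (Finset.mem_univ z)]
  simp only [Nat.lt_succ_self, if_true]
  congr 1
  refine Finset.prod_congr rfl fun a ha => ?_
  have hne : a ≠ z := (Finset.mem_erase.1 ha).1
  have : a.val < z.val + 1 ↔ a < z := by
    rw [Fin.lt_def]
    have : a.val ≠ z.val := fun h => hne (Fin.ext h)
    omega
  simp only [this]

lemma genH_tele (q : K) (x : Fin N → K) (m : ℕ) (hm : m ≤ N) :
    ∑ a : Fin N, (if a.val < m then Polynomial.C ((q - 1) * x a) * Polynomial.X * genE q x a else 0) =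
      genH q x m - genH q x 0 := by
  induction m with
  | zero => simp
  | succ m ih =>
    have h1 := ih (by omega)
    let z : Fin N := ⟨m, by omega⟩
    have h2 : ∀ a : Fin N, (if a.val < m + 1 then Polynomial.C ((q - 1) * x a) * Polynomial.X * genE q x a else 0) =
        (if a.val < m then Polynomial.C ((q - 1) * x a) * Polynomial.X * genE q x a else 0) +
        (if a = z then Polynomial.C ((q - 1) * x a) * Polynomial.X * genE q x a else 0) := by
      intro a
      have : a = z ↔ a.val = m := by rw [Fin.ext_iff]
      simp only [this]
      rcases lt_trichotomy a.val m with h | h | h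
      · simp [h, h.ne, Nat.lt_succ_of_lt h]
      · simp [h]
      · have h3 : ¬ a.val < m + 1 := by omega
        simp [h.ne', h.not_gt, h3]
    simp only [h2]
    rw [Finset.sum_add_distrib, h1, Finset.sum_ite_eq' Finset.univ z]
    have e1 := genH_eq q x z
    have e2 := genH_succ q x z
    simp only [z] at e1 e2
    simp only [Finset.mem_univ, if_true, z]
    rw [e1, e2]
    simp only [Polynomial.C_mul, Polynomial.C_sub, Polynomial.C_1]
    ring

/-- The elementary symmetric functions, shifted by one. -/
noncomputable def eC (x : Fin N → K) (c : ℕ) : K := (genH 1 x 0).coeff c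

lemma genH_zero (q : K) (x : Fin N → K) : genH q x 0 = genH 1 x 0 := by
  simp [genH]

lemma genH_top (q : K) (x : Fin N → K) (c : ℕ) : (genH q x N).coeff c = q ^ c * eC x c := by
  have : genH q x N = (genH 1 x 0).comp (Polynomial.C q * Polynomial.X) := by
    simp [genH, Polynomial.prod_comp]
    refine Finset.prod_congr rfl fun a _ => ?_
    ring
  rw [this, Polynomial.comp_C_mul_X_coeff, eC]
  ring

/-- The values of theta. -/
noncomputable def tF (q : K) (x : Fin N → K) (c : ℕ) (z : Fin N) : K := x z * (genE q x z).coeff c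

lemma tele_coeff (q : K) (x : Fin N → K) (m : ℕ) (hm : m ≤ N) (c : ℕ) :
    ∑ a : Fin N, (if a.val < m then (q - 1) * tF q x c a else 0) =
      (genH q x m).coeff (c + 1) - eC x (c + 1) := by
  have h := congrArg (fun p => p.coeff (c + 1)) (genH_tele q x m hm)
  simp only [Polynomial.finsetSum_coeff, Polynomial.coeff_sub] at h
  rw [genH_zero] at h
  rw [eC, ← h]
  refine Finset.sum_congr rfl fun a _ => ?_
  split_ifs
  · rw [mul_assoc, Polynomial.coeff_C_mul, Polynomial.coeff_X_mul, tF]; ring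
  · simp

lemma tF_zero (q : K) (x : Fin N → K) (z : Fin N) : tF q x 0 z = x z := by
  have : (genE q x z).coeff 0 = 1 := by
    rw [genE, Polynomial.coeff_zero_eq_eval_zero, Polynomial.eval_prod]
    refine Finset.prod_eq_one fun a _ => ?_
    split_ifs <;> simp
  rw [tF, this, mul_one]

lemma tF_sum (q : K) (hq1 : q ≠ 1) (x : Fin N → K) (c : ℕ) :
    ∑ z, tF q x c z = (∑ i ∈ Finset.range (c + 1), q ^ i) * eC x (c + 1) := by
  have h := tele_coeff q x N le_rfl c
  simp only [Fin.is_lt, if_true, ← Finset.mul_sum] at h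
  rw [genH_top] at h
  have h0 : q - 1 ≠ 0 := sub_ne_zero.2 hq1
  apply mul_left_cancel₀ h0
  rw [h]
  have := mul_geom_sum q (c + 1)
  linear_combination -eC x (c + 1) * this

lemma tF_phi (q : K) (x : Fin N → K) (c : ℕ) (z : Fin N) :
    ∑ y, (wF q x [y] z - wF q x [] z) * tF q x c y =
      tF q x (c + 1) z - eC x (c + 1) * tF q x 0 z := by
  have h := tele_coeff q x z.val z.2.le c
  rw [genH_eq, add_mul, one_mul, Polynomial.coeff_add, mul_assoc, Polynomial.coeff_C_mul, Polynomial.coeff_X_mul] at h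
  have h2 : ∀ y, (wF q x [y] z - wF q x [] z) * tF q x c y =
      x z * (if y.val < z.val then (q - 1) * tF q x c y else 0) -
        (if y = z then x z * tF q x c y else 0) := by
    intro y
    rw [wF_cons, wF_nil, fW]
    rcases lt_trichotomy y z with h | h | h
    · simp [h, h.ne, Fin.lt_def.1 h]; ring
    · simp [h]
    · have := Fin.lt_def.1 h
      simp [h.ne', h.not_gt, this.not_gt]
  simp only [h2]
  rw [Finset.sum_sub_distrib, ← Finset.mul_sum, h, Finset.sum_ite_eq' Finset.univ z, tF_zero]
  simp only [Finset.mem_univ, if_true, tF]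
  ring

end ColourSystem


/-! ### The column system -/

section ColumnSystem

variable {K : Type*} [Field K] {N : ℕ}

/-- Interaction of columns (indexed from zero). -/
noncomputable def hP (q : K) (u : ℕ → K) (c s : ℕ) : K :=
  if c = s + 1 then 1 else q * (u c - u s) / (q * u c - u s)

/-- Indicator that the column `c` may be added. -/
noncomputable def iP (K : Type*) [Field K] (l : List (Fin N)) (c : Fin N) : K :=
  if c.val = 0 ∨ ∃ a ∈ l, a.val + 1 = c.val then 1 else 0

/-- Weight of a column. -/
noncomputable def wP (q : K) (u : ℕ → K) (g : Fin N → K) (l : List (Fin N)) (c : Fin N) : K :=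
  g c * iP K l c * (l.map fun s => hP q u c.val s.val).prod

lemma iP_cons (y : Fin N) (l : List (Fin N)) (c : Fin N) :
    iP K (y :: l) c = if c.val = y.val + 1 then 1 else iP K l c := by
  unfold iP
  by_cases h : c.val = y.val + 1
  · have : y.val + 1 = c.val := h.symm
    simp [h]
  · have : ¬ (y.val + 1 = c.val) := fun h' => h h'.symm
    simp [h, this]

lemma iP_zero (l : List (Fin N)) (y c : Fin N) (h : c.val = y.val + 1) (hy : y ∉ l) :
    iP K l c = 0 := by
  unfold iP
  rw [if_neg]
  rintro (h0 | ⟨a, ha, h1⟩)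
  · omega
  · have : a = y := Fin.ext (by omega)
    exact hy (this ▸ ha)

lemma wP_cons (q : K) (u : ℕ → K) (g : Fin N → K) (y : Fin N) (l : List (Fin N)) (c : Fin N) :
    wP q u g (y :: l) c = g c * (if c.val = y.val + 1 then 1 else iP K l c) *
      (hP q u c.val y.val * (l.map fun s => hP q u c.val s.val).prod) := by
  rw [wP, iP_cons, List.map_cons, List.prod_cons]

lemma hP_self (q : K) (u : ℕ → K) (c : ℕ) : hP q u c c = 0 := by simp [hP]

/-- Exchange coefficients. -/
noncomputable def aP (q : K) (u : ℕ → K) (a b : Fin N) : K :=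
  (q - 1) * u a.val / (u a.val - u b.val)

/-- Exchange coefficients. -/
noncomputable def bP (q : K) (u : ℕ → K) (a b : Fin N) : K :=
  (q * u a.val - u b.val) / (u a.val - u b.val)

set_option maxHeartbeats 4000000 in
lemma labSysP (q : K) (u : ℕ → K) (g : Fin N → K) (hu : ∀ s, u s = q * u (s + 1))
    (hinj : Function.Injective u) (hq : q ≠ 0) : LabSys q (wP q u g) (aP q u) (bP q u) := by
  have hne : ∀ a b : Fin N, a ≠ b → u a.val - u b.val ≠ 0 := fun a b hab =>
    sub_ne_zero.2 fun h => hab (Fin.ext (hinj h))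
  have hne2 : ∀ a b : Fin N, a.val ≠ b.val + 1 → q * u a.val - u b.val ≠ 0 := by
    intro a b hab h
    apply hab
    rw [hu b.val, sub_eq_zero] at h
    exact hinj (mul_left_cancel₀ hq h)
  have hadj : ∀ a b : Fin N, a.val = b.val + 1 → u b.val = q * u a.val := by
    intro a b hab
    rw [hab]; exact hu _
  have hu0 : ∀ a, u a ≠ 0 := by
    intro a ha
    have h1 := hu a
    rw [ha] at h1
    have h2 : u (a + 1) = 0 := by
      rcases mul_eq_zero.1 h1.symm with h | h
      · exact absurd h hq
      · exact h
    have := hinj (ha.trans h2.symm)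
    omega
  have hq1 : q - 1 ≠ 0 := by
    intro h
    have h1 := hu 0
    rw [sub_eq_zero.1 h, one_mul] at h1
    have := hinj h1
    omega
  have hq2 : 1 - q ≠ 0 := fun h => hq1 (by linear_combination -h)
  refine ⟨?_, ?_, ?_, ?_, ?_, ?_, ?_⟩
  · intro l l' c h
    unfold wP iP
    rw [(h.map _).prod_eq]
    simp only [h.mem_iff]
  · intro l c h
    have : (0 : K) ∈ l.map fun s => hP q u c.val s.val :=
      List.mem_map.2 ⟨c, h, hP_self _ _ _⟩
    rw [wP, List.prod_eq_zero this, mul_zero]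
  · intro a b hab
    have h1 := hne a b hab
    have h2 := hne b a hab.symm
    unfold aP bP
    generalize u a.val = x at *
    generalize u b.val = y at *
    have : y - x = -(x - y) := by ring
    rw [this]
    field_simp
    ring
  · intro a b hab
    have h1 := hne a b hab
    have h2 := hne b a hab.symm
    unfold aP
    generalize u a.val = x at *
    generalize u b.val = y at *
    have : y - x = -(x - y) := by ring
    rw [this]
    field_simp
    ring
  · intro l z w hl hz hw hzw
    have h1 := hne z w hzw
    have h1' := hne w z hzw.symm
    simp only [wP_cons]
    unfold wP aP bP
    have k1 := hne2 z w
    have k2 := hne2 w z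
    have k3 := hadj z w
    have k4 := hadj w z
    have k5 := iP_zero (K := K) l z w
    have k6 := iP_zero (K := K) l w z
    generalize iP K l z = iz at *
    generalize iP K l w = iw at *
    generalize (l.map fun s => hP q u z.val s.val).prod = Pz at *
    generalize (l.map fun s => hP q u w.val s.val).prod = Pw at *
    unfold hP
    have z0 := hu0 z.val
    generalize u z.val = uz at *
    have w0 := hu0 w.val
    generalize u w.val = uw at *
    by_cases c1 : w.val = z.val + 1
    · have c2 : ¬ z.val = w.val + 1 := by omega
      have i0 := k5 c1 hz
      have := k4 c1
      subst this
      simp only [if_pos c1, if_neg c2, i0, if_true]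
      field_simp
      ring
    · by_cases c2 : z.val = w.val + 1
      · have i0 := k6 c2 hw
        have := k3 c2
        subst this
        simp only [if_neg c1, if_pos c2, i0, if_true]
        ring
      · have := k2 c1
        have := k1 c2
        have e1 : uw - uz = -(uz - uw) := by ring
        simp only [if_neg c1, if_neg c2, if_true]
        rw [e1]
        field_simp
        ring
  · intro l y z w hl hy hz hw hzw
    have h1 := hne z w hzw
    have h1' := hne w z hzw.symm
    simp only [wP_cons, iP_cons, List.map_cons, List.prod_cons]
    unfold wP aP bP
    have k1 := hne2 z w
    have k2 := hne2 w z
    have k3 := hadj z w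
    have k4 := hadj w z
    have k5 := iP_zero (K := K) l z w
    have k6 := iP_zero (K := K) l w z
    have m1 := hne2 z y
    have m2 := hne2 w y
    have m3 := hadj z y
    have m4 := hadj w y
    have m5 := iP_zero (K := K) l y z
    have m6 := iP_zero (K := K) l y w
    generalize iP K l z = iz at *
    generalize iP K l w = iw at *
    generalize (l.map fun s => hP q u z.val s.val).prod = Pz at *
    generalize (l.map fun s => hP q u w.val s.val).prod = Pw at *
    unfold hP
    have hyz : z ≠ y → u z.val - u y.val ≠ 0 := hne z y
    have hzz : z = y → u z.val = u y.val := fun h => by rw [h]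
    have hww : w = y → u w.val = u y.val := fun h => by rw [h]
    have z0 := hu0 z.val
    generalize u z.val = uz at *
    have w0 := hu0 w.val
    generalize u w.val = uw at *
    have y0 := hu0 y.val
    generalize u y.val = uy at *
    have e1 : uw - uz = -(uz - uw) := by ring
    by_cases c1 : w.val = z.val + 1
    · have c2 : ¬ z.val = w.val + 1 := by omega
      have i1 := k5 c1 hz
      have i2 := k4 c1
      subst i2
      by_cases c3 : z.val = y.val + 1
      · have c4 : ¬ w.val = y.val + 1 := by omega
        have n1 := m2 c4
        have i3 := m3 c3
        have i4 := m5 c3 hy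
        subst i3
        simp only [if_pos c1, if_neg c2, if_pos c3, if_neg c4, i1, i4, if_true]
        field_simp
        ring
      · by_cases c4 : w.val = y.val + 1
        · have : z = y := Fin.ext (by omega)
          have := hzz this
          subst this
          have n0 := k1 c2
          have n0' : q ^ 2 - 1 ≠ 0 := fun h => n0 (by linear_combination uw * h)
          simp only [if_pos c1, if_neg c2, if_neg c3, if_pos c4, i1, if_true]
          field_simp
          ring
        · have n1 := m2 c4
          have n2 := m1 c3
          have n0 := k1 c2
          have n0' : q ^ 2 - 1 ≠ 0 := fun h => n0 (by linear_combination uw * h)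
          have n3 : q ^ 2 * uw - uy ≠ 0 := fun h => n2 (by linear_combination h)
          simp only [if_pos c1, if_neg c2, if_neg c3, if_neg c4, i1, if_true]
          field_simp
          ring
    · by_cases c2 : z.val = w.val + 1
      · have i1 := k6 c2 hw
        have i2 := k3 c2
        subst i2
        have n0 := k2 c1
        by_cases c3 : z.val = y.val + 1
        · have : w = y := Fin.ext (by omega)
          have := hww this
          subst this
          have c4 : ¬ w.val = y.val + 1 := by omega
          have n0' : q ^ 2 - 1 ≠ 0 := fun h => n0 (by linear_combination uz * h)
          simp only [if_neg c1, if_pos c2, if_pos c3, if_neg c4, i1, if_true]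
          field_simp
          ring
        · have n2 := m1 c3
          by_cases c4 : w.val = y.val + 1
          · have i3 := m4 c4
            have i4 := m6 c4 hy
            simp only [if_neg c1, if_pos c2, if_neg c3, if_pos c4, i1, i4, if_true]
            simp
          · simp only [if_neg c1, if_pos c2, if_neg c3, if_neg c4, i1, if_true]
            simp
      · have n0 := k1 c2
        have n0' := k2 c1
        by_cases c3 : z.val = y.val + 1
        · have c4 : ¬ w.val = y.val + 1 := fun h => hzw (Fin.ext (by omega))
          have n1 := m2 c4
          have i3 := m3 c3
          have i4 := m5 c3 hy
          subst i3
          simp only [if_neg c1, if_neg c2, if_pos c3, if_neg c4, i4, if_true]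
          rw [e1]
          field_simp
          ring
        · have n2 := m1 c3
          by_cases c4 : w.val = y.val + 1
          · have i3 := m4 c4
            have i4 := m6 c4 hy
            subst i3
            simp only [if_neg c1, if_neg c2, if_neg c3, if_pos c4, i4, if_true]
            rw [e1]
            field_simp
            ring
          · have n1 := m2 c4
            simp only [if_neg c1, if_neg c2, if_neg c3, if_neg c4, if_true]
            rw [e1]
            field_simp
            ring
  · intro l y y' z hl hy hy' hz hyy
    have h1 := hne y y' hyy
    simp only [wP_cons, iP_cons, List.map_cons, List.prod_cons]
    unfold wP aP bP
    have m1 := hne2 z y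
    have m2 := hne2 z y'
    have m3 := hadj z y
    have m4 := hadj z y'
    have m5 := iP_zero (K := K) l y z
    have m6 := iP_zero (K := K) l y' z
    generalize iP K l z = iz at *
    generalize (l.map fun s => hP q u z.val s.val).prod = Pz at *
    unfold hP
    have z0 := hu0 z.val
    generalize u z.val = uz at *
    have y0 := hu0 y.val
    generalize u y.val = uy at *
    generalize u y'.val = uw at *
    have e1 : uw - uy = -(uy - uw) := by ring
    by_cases c1 : z.val = y.val + 1
    · have c2 : ¬ z.val = y'.val + 1 := fun h => hyy (Fin.ext (by omega))
      have i1 := m5 c1 hy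
      have i2 := m3 c1
      have n1 := m2 c2
      subst i2
      simp only [if_pos c1, if_neg c2, i1, if_true]
      rw [e1]
      field_simp
      ring
    · have n2 := m1 c1
      by_cases c2 : z.val = y'.val + 1
      · have i1 := m6 c2 hy'
        have i2 := m4 c2
        subst i2
        simp only [if_neg c1, if_pos c2, i1, if_true]
        rw [e1]
        field_simp
        ring
      · have n1 := m2 c2
        simp only [if_neg c1, if_neg c2, if_true]
        rw [e1]
        field_simp
        ring

end ColumnSystem

/-! ### Comparison of colourings with columns -/

section ColumnCompare

variable {K : Type*} [Field K] {N : ℕ}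

/-- The `q`-integer in a field. -/
noncomputable def br (q : K) (n : ℕ) : K := ∑ i ∈ Finset.range n, q ^ i

lemma br_mul (q : K) (n : ℕ) : (q - 1) * br q n = q ^ n - 1 := mul_geom_sum q n

lemma br_zero (q : K) : br q 0 = 0 := by simp [br]

lemma br_one (q : K) : br q 1 = 1 := by simp [br]

lemma br_succ (q : K) (n : ℕ) : br q (n + 1) = q * br q n + 1 := by
  rw [br, br, Finset.sum_range_succ', Finset.mul_sum]
  simp [pow_succ, mul_comm]

lemma br_ne (q : K) (hq : ∀ n, 1 ≤ n → q ^ n ≠ 1) (n : ℕ) (hn : 1 ≤ n) : br q n ≠ 0 := by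
  intro h
  have := br_mul q n
  rw [h, mul_zero] at this
  exact hq n hn (sub_eq_zero.1 this.symm)

lemma br_eq (q : K) (hq1 : q ≠ 1) (n : ℕ) : br q n = (q ^ n - 1) / (q - 1) := by
  rw [← br_mul, mul_div_cancel_left₀ _ (sub_ne_zero.2 hq1)]

/-- The interaction written with `q`-integers. -/
noncomputable def hB (q : K) (c s : ℕ) : K :=
  if s + 1 = c then 1
  else if c ≤ s then q * br q (s - c) / br q (s + 1 - c)
  else br q (c - s) / br q (c - s - 1)

lemma hP_eq (q : K) (hq0 : q ≠ 0) (hq : ∀ n, 1 ≤ n → q ^ n ≠ 1) (c s : ℕ) :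
    hP q (fun i => q⁻¹ ^ i) c s = hB q c s := by
  have hq1 : q ≠ 1 := by simpa using hq 1 le_rfl
  have hq1' := sub_ne_zero.2 hq1
  have hs : ∀ n, 1 ≤ n → q ^ n - 1 ≠ 0 := fun n hn => sub_ne_zero.2 (hq n hn)
  unfold hP hB
  by_cases h : s + 1 = c
  · rw [if_pos h.symm, if_pos h]
  rw [if_neg fun h' => h h'.symm, if_neg h]
  split_ifs with h2
  · obtain ⟨d, rfl⟩ := Nat.exists_eq_add_of_le h2
    have e1 : c + d - c = d := by omega
    have e2 : c + d + 1 - c = d + 1 := by omega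
    rw [e1, e2, br_eq q hq1, br_eq q hq1]
    have h3 := hs (d + 1) (by omega)
    have hc : q ^ c ≠ 0 := pow_ne_zero _ hq0
    have hd : q ^ d ≠ 0 := pow_ne_zero _ hq0
    have e3 : q * q⁻¹ ^ c - q⁻¹ ^ (c + d) = (q ^ (d + 1) - 1) / (q ^ c * q ^ d) := by
      rw [inv_pow, inv_pow, pow_add, pow_succ]; field_simp
    have e4 : q⁻¹ ^ c - q⁻¹ ^ (c + d) = (q ^ d - 1) / (q ^ c * q ^ d) := by
      rw [inv_pow, inv_pow, pow_add]; field_simp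
    simp only
    rw [e3, e4]
    field_simp
  · obtain ⟨d, rfl⟩ : ∃ d, c = s + (d + 2) := ⟨c - s - 2, by omega⟩
    have e1 : s + (d + 2) - s = d + 2 := by omega
    have e2 : d + 2 - 1 = d + 1 := by omega
    rw [e1, e2, br_eq q hq1, br_eq q hq1]
    have h3 := hs (d + 1) (by omega)
    have hc : q ^ s ≠ 0 := pow_ne_zero _ hq0
    have hd : q ^ d ≠ 0 := pow_ne_zero _ hq0
    have e3 : q * q⁻¹ ^ (s + (d + 2)) - q⁻¹ ^ s = - (q ^ (d + 1) - 1) / (q ^ s * q ^ (d + 1)) := by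
      rw [inv_pow, inv_pow, pow_add, pow_succ, pow_succ]; field_simp; ring
    have e4 : q⁻¹ ^ (s + (d + 2)) - q⁻¹ ^ s = - (q ^ (d + 2) - 1) / (q ^ s * q ^ (d + 2)) := by
      rw [inv_pow, inv_pow, pow_add, pow_succ, pow_succ]; field_simp; ring
    simp only
    rw [e3, e4]
    have h5 : q ^ (d + 2) = q ^ (d + 1) * q := pow_succ _ _
    have hd1 : q ^ (d + 1) ≠ 0 := pow_ne_zero _ hq0
    rw [h5]
    field_simp

lemma eC_zero (x : Fin N → K) : eC x 0 = 1 := by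
  unfold eC genH
  rw [Polynomial.coeff_zero_eq_eval_zero, Polynomial.eval_prod]
  refine Finset.prod_eq_one fun a _ => ?_
  simp

lemma eC_top (x : Fin N → K) (c : ℕ) (hc : N < c) : eC x c = 0 := by
  unfold eC genH
  apply Polynomial.coeff_eq_zero_of_natDegree_lt
  refine lt_of_le_of_lt (Polynomial.natDegree_prod_le _ _) ?_
  refine lt_of_le_of_lt (Finset.sum_le_card_nsmul _ _ 1 ?_) (by simpa using hc)
  intro a _
  simp only [Nat.not_lt_zero, if_false]
  compute_degree

/-- Weight attached to a column of index `c` (from zero). -/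
noncomputable def gB (q : K) (x : Fin N → K) (c : Fin N) : K :=
  (if c.val = 0 then 1 else br q (c.val + 1) / br q c.val) * (eC x (c.val + 1) / eC x c.val)

theorem colour_eq_column (q : K) (hq0 : q ≠ 0) (hq : ∀ n, 1 ≤ n → q ^ n ≠ 1) (x : Fin N → K)
    (hx : ∀ c, c ≤ N → eC x c ≠ 0) (ds : List ℕ) (hds : legal 0 ds) :
    bval (wF q x) ds [] = bval (wP q (fun i => q⁻¹ ^ i) (gB q x)) ds [] := by
  have hq1 : q ≠ 1 := by simpa using hq 1 le_rfl
  have hinj : Function.Injective fun i : ℕ => q⁻¹ ^ i := by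
    have key : ∀ i d : ℕ, q⁻¹ ^ i = q⁻¹ ^ (i + d) → d = 0 := by
      intro i d h
      by_contra hd
      have hi : q ^ i ≠ 0 := pow_ne_zero _ hq0
      have hd' : q ^ d ≠ 0 := pow_ne_zero _ hq0
      rw [inv_pow, inv_pow, inv_inj, pow_add] at h
      exact hq d (by omega) (by
        have := mul_left_cancel₀ hi (h.symm.trans (mul_one _).symm)
        exact this)
    intro i j h
    rcases le_total i j with hij | hij
    · obtain ⟨d, rfl⟩ := Nat.exists_eq_add_of_le hij
      have := key i d h
      omega
    · obtain ⟨d, rfl⟩ := Nat.exists_eq_add_of_le hij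
      have := key j d h.symm
      omega
  refine bval_eq_bval' (labSysF q x) (labSysP q _ (gB q x) ?_ hinj hq0) (tF q x)
    (fun c z => if z.val = c then br q (c + 1) * eC x (c + 1) else 0)
    (fun c => eC x (c + 1)) (fun c => br q (c + 1) * eC x (c + 1)) ?_ ?_ ?_ ?_ ?_ ?_ ds hds
  · intro s
    simp only [pow_succ]
    field_simp
  · intro z; rw [tF_zero, wF_nil]
  · intro z
    by_cases hz : z.val = 0
    · simp [wP, iP, gB, hz, eC_zero, br_one]
    · simp [wP, iP, hz]
  · intro c z; exact tF_phi q x c z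
  · intro c z
    have hz' := z.isLt
    by_cases hc : c < N
    · rw [Finset.sum_eq_single (⟨c, hc⟩ : Fin N)]
      · simp only [if_true]
        rw [wP_cons, hP_eq q hq0 hq]
        by_cases hz : z.val = 0
        · have h1 := br_ne q hq (c + 1) (by omega)
          have h0 : ¬ (0 = c + 1) := by omega
          have e1 := br_succ q c
          simp [wP, iP, gB, hz, eC_zero, br_one, hB]
          field_simp
          rw [e1]; ring
        · by_cases hz1 : z.val = c + 1
          · have h1 := br_ne q hq (c + 1) (by omega)
            have h2 := hx (c + 1) (by omega)
            simp [wP, iP, gB, hz, hz1, hB]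
            field_simp
          · simp [wP, iP, hz, hz1]
      · intro b _ hb
        rw [if_neg fun h => hb (Fin.ext h), mul_zero]
      · simp
    · rw [Finset.sum_eq_zero, eC_top x (c + 1) (by omega)]
      · rw [if_neg (by omega)]; simp
      · intro b _
        rw [if_neg (by omega), mul_zero]
  · intro c; rw [tF_sum q hq1]; rfl
  · intro c
    by_cases hc : c < N
    · rw [Finset.sum_eq_single (⟨c, hc⟩ : Fin N)]
      · simp
      · intro b _ hb
        rw [if_neg fun h => hb (Fin.ext h)]
      · simp
    · rw [Finset.sum_eq_zero, eC_top x (c + 1) (by omega), mul_zero]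
      intro b _
      rw [if_neg (by omega)]

end ColumnCompare

/-! ### From unit interval graphs to words -/

section GraphWord

variable {K : Type*} [Field K] {L : Type*} [Fintype L]

/-- The contribution of a single sequence of labels. -/
def pval (ω : List L → L → K) : List ℕ → List L → (ℕ → L) → K
  | [], _, _ => 1
  | d :: ds, l, κ => ω (l.drop d) (κ 0) * pval ω ds (l.drop d ++ [κ 0]) (fun i => κ (i + 1))

/-- Extension of a finite sequence. -/
def extFin [Inhabited L] {m : ℕ} (κ : Fin m → L) (i : ℕ) : L :=
  if h : i < m then κ ⟨i, h⟩ else default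

lemma bval_eq_sum [Inhabited L] (ω : List L → L → K) : ∀ (ds : List ℕ) (l : List L),
    bval ω ds l = ∑ κ : Fin ds.length → L, pval ω ds l (extFin κ) := by
  intro ds
  induction ds with
  | nil => intro l; simp [bval, pval]
  | cons d ds ih =>
    intro l
    rw [bval]
    have e := Fintype.sum_equiv (Fin.consEquiv (fun _ : Fin (ds.length + 1) => L))
      (fun p => pval ω (d :: ds) l (extFin (Fin.cons p.1 p.2 : Fin (ds.length + 1) → L)))
      (fun κ : Fin (ds.length + 1) → L => pval ω (d :: ds) l (extFin κ)) (fun p => rfl)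
    refine Eq.trans ?_ e
    rw [Fintype.sum_prod_type]
    refine Finset.sum_congr rfl fun c _ => ?_
    rw [ih, Finset.mul_sum]
    refine Finset.sum_congr rfl fun κ _ => ?_
    have e0 : extFin (Fin.cons c κ : Fin (ds.length + 1) → L) 0 = c := by
      simp [extFin]
    have e1 : (fun i => extFin (Fin.cons c κ : Fin (ds.length + 1) → L) (i + 1)) = extFin κ := by
      funext i
      unfold extFin
      by_cases h : i < ds.length
      · have h' : i + 1 < ds.length + 1 := by omega
        rw [dif_pos h, dif_pos h']
        rfl
      · have h' : ¬ i + 1 < ds.length + 1 := by omega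
        rw [dif_neg h, dif_neg h']
    rw [pval, e0, e1]

/-- Previous left endpoint. -/
def prevL (le : ℕ → ℕ) : ℕ → ℕ
  | 0 => 0
  | j + 1 => le j

/-- The word from left endpoints. -/
def dsFrom (le : ℕ → ℕ) : ℕ → ℕ → List ℕ
  | _, 0 => []
  | j, m + 1 => (le j - prevL le j) :: dsFrom le (j + 1) m

lemma dsFrom_length (le : ℕ → ℕ) (m : ℕ) : ∀ j, (dsFrom le j m).length = m := by
  induction m with
  | zero => intro j; rfl
  | succ m ih => intro j; simp [dsFrom, ih]

lemma prevL_le (le : ℕ → ℕ) (h1 : ∀ j, le j ≤ j) (j : ℕ) : prevL le j ≤ j := by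
  cases j with
  | zero => simp [prevL]
  | succ j => have := h1 j; simp only [prevL]; omega

lemma prevL_mono (le : ℕ → ℕ) (h2 : ∀ j, le j ≤ le (j + 1)) (j : ℕ) : prevL le j ≤ le j := by
  cases j with
  | zero => simp [prevL]
  | succ j => exact h2 j

lemma dsFrom_legal (le : ℕ → ℕ) (h1 : ∀ j, le j ≤ j) (h2 : ∀ j, le j ≤ le (j + 1)) (m : ℕ) :
    ∀ j, legal (j - prevL le j) (dsFrom le j m) := by
  induction m with
  | zero => intro j; trivial
  | succ m ih =>
    intro j
    have a1 := h1 j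
    have a2 := prevL_le le h1 j
    have a3 := prevL_mono le h2 j
    refine ⟨by omega, ?_⟩
    have := ih (j + 1)
    have e' : prevL le (j + 1) = le j := rfl
    have e : j + 1 - prevL le (j + 1) = j - prevL le j - (le j - prevL le j) + 1 := by
      rw [e']; omega
    rwa [e] at this

lemma pval_dsFrom (ω : List L → L → K) (le : ℕ → ℕ) (h1 : ∀ j, le j ≤ j)
    (h2 : ∀ j, le j ≤ le (j + 1)) (κ : ℕ → L) (m : ℕ) : ∀ j,
    pval ω (dsFrom le j m) ((List.range' (prevL le j) (j - prevL le j)).map κ) (fun i => κ (j + i)) =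
      ∏ i ∈ Finset.range m, ω ((List.range' (le (j + i)) (j + i - le (j + i))).map κ) (κ (j + i)) := by
  induction m with
  | zero => intro j; simp [dsFrom, pval]
  | succ m ih =>
    intro j
    have a1 := h1 j
    have a2 := prevL_le le h1 j
    have a3 := prevL_mono le h2 j
    have e0 : ((List.range' (prevL le j) (j - prevL le j)).map κ).drop (le j - prevL le j) =
        (List.range' (le j) (j - le j)).map κ := by
      rw [← List.map_drop, List.drop_range']
      congr 2 <;> omega
    have e1 : (List.range' (le j) (j - le j)).map κ ++ [κ j] =
        (List.range' (prevL le (j + 1)) (j + 1 - prevL le (j + 1))).map κ := by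
      have : j + 1 - le j = (j - le j) + 1 := by omega
      simp only [prevL]
      rw [this, List.range'_concat]
      simp
      congr 1; omega
    rw [dsFrom, pval, e0, Finset.prod_range_succ']
    simp only [Nat.add_zero]
    rw [e1, mul_comm]
    congr 1
    have := ih (j + 1)
    have e2 : (fun i => κ (j + (i + 1))) = fun i => κ (j + 1 + i) := by
      funext i; congr 1; omega
    rw [e2, this]
    refine Finset.prod_congr rfl fun i _ => ?_
    have : j + 1 + i = j + (i + 1) := by omega
    rw [this]

/-- Adjacency on natural numbers. -/
def adjN {n : ℕ} (G : SimpleGraph (Fin n)) (i j : ℕ) : Prop :=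
  ∃ (hi : i < n) (hj : j < n), G.Adj ⟨i, hi⟩ ⟨j, hj⟩

lemma left_exists {n : ℕ} (G : SimpleGraph (Fin n)) (j : ℕ) :
    ∃ a, ∀ i, a ≤ i → i < j → adjN G i j := ⟨j, fun i h1 h2 => absurd h1 (by omega)⟩

/-- Left endpoint of the neighbourhood. -/
noncomputable def leftG {n : ℕ} (G : SimpleGraph (Fin n)) (j : ℕ) : ℕ := Nat.find (left_exists G j)

lemma leftG_le {n : ℕ} (G : SimpleGraph (Fin n)) (j : ℕ) : leftG G j ≤ j :=
  Nat.find_min' _ fun i h1 h2 => absurd h1 (by omega)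

lemma leftG_iff {n : ℕ} (G : SimpleGraph (Fin n)) (hG : IsNUIG G) (i j : ℕ) (hij : i < j) :
    adjN G i j ↔ leftG G j ≤ i := by
  constructor
  · rintro ⟨hi, hj, h⟩
    refine Nat.find_min' _ fun i' h1 h2 => ?_
    rcases h1.eq_or_lt with rfl | h1
    · exact ⟨hi, hj, h⟩
    · exact ⟨by omega, hj, (hG ⟨i, hi⟩ ⟨i', by omega⟩ ⟨j, hj⟩ h1 h2 h).2⟩
  · intro h
    exact Nat.find_spec (left_exists G j) i h hij

lemma leftG_mono {n : ℕ} (G : SimpleGraph (Fin n)) (hG : IsNUIG G) (j : ℕ) :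
    leftG G j ≤ leftG G (j + 1) := by
  refine Nat.find_min' _ fun i h1 h2 => ?_
  obtain ⟨hi, hj, h⟩ := (leftG_iff G hG i (j + 1) (by omega)).2 h1
  exact ⟨hi, by omega, (hG ⟨i, hi⟩ ⟨j, by omega⟩ ⟨j + 1, hj⟩ h2 (Nat.lt_succ_self j) h).1⟩

/-- The word of a unit interval graph. -/
noncomputable def wordG {n : ℕ} (G : SimpleGraph (Fin n)) : List ℕ := dsFrom (leftG G) 0 n

lemma wordG_legal {n : ℕ} (G : SimpleGraph (Fin n)) (hG : IsNUIG G) : legal 0 (wordG G) :=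
  dsFrom_legal (leftG G) (leftG_le G) (leftG_mono G hG) n 0

lemma colour_weight {n N : ℕ} (G : SimpleGraph (Fin n)) (q : K) (κ : Fin n → Fin N) :
    ∏ j : Fin n, ∏ i : Fin n, (if G.Adj i j ∧ i < j then fW q (κ i) (κ j) else 1) =
      if IsProper G κ then q ^ ascNum G κ else 0 := by
  by_cases hp : IsProper G κ
  · rw [if_pos hp]
    have : ∀ i j : Fin n, (if G.Adj i j ∧ i < j then fW q (κ i) (κ j) else 1) =
        if G.Adj i j ∧ i < j ∧ κ i < κ j then q else 1 := by
      intro i j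
      by_cases h : G.Adj i j ∧ i < j
      · have := hp i j h.1
        simp [h.1, h.2, fW, this]
      · rw [if_neg h, if_neg fun h' => h ⟨h'.1, h'.2.1⟩]
    simp only [this]
    rw [Finset.prod_comm, ← Fintype.prod_prod_type', ascNum, Finset.prod_ite, Finset.prod_const_one, mul_one,
      Finset.prod_const]
  · rw [if_neg hp]
    unfold IsProper at hp
    push Not at hp
    obtain ⟨i, j, h, hk⟩ := hp
    have key : ∀ a b : Fin n, G.Adj a b → κ a = κ b → a < b →
        ∏ j : Fin n, ∏ i : Fin n, (if G.Adj i j ∧ i < j then fW q (κ i) (κ j) else 1) = 0 := by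
      intro a b h hk hlt
      refine Finset.prod_eq_zero (Finset.mem_univ b) (Finset.prod_eq_zero (Finset.mem_univ a) ?_)
      simp [h, hlt, fW, hk]
    rcases lt_trichotomy i j with hl | hl | hl
    · exact key i j h hk hl
    · exact absurd hl h.ne
    · exact key j i h.symm hk.symm hl

theorem bval_wordG {n N : ℕ} [Inhabited (Fin N)] (G : SimpleGraph (Fin n)) (hG : IsNUIG G) (q : K)
    (x : Fin N → K) : bval (wF q x) (wordG G) [] =
      ∑ κ : Fin n → Fin N, if IsProper G κ then q ^ ascNum G κ * ∏ i, x (κ i) else 0 := by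
  have hl : (wordG G).length = n := dsFrom_length _ _ _
  rw [bval_eq_sum]
  have e : ∀ m (hm : m = n), ∑ κ : Fin m → Fin N, pval (wF q x) (wordG G) [] (extFin κ) =
      ∑ κ : Fin n → Fin N, pval (wF q x) (wordG G) [] (extFin κ) := by
    intro m hm; subst hm; rfl
  rw [e _ hl]
  refine Finset.sum_congr rfl fun κ _ => ?_
  have h := pval_dsFrom (wF q x) (leftG G) (leftG_le G) (leftG_mono G hG) (extFin κ) n 0
  simp only [Nat.zero_add, prevL, Nat.sub_zero, List.range'_zero, List.map_nil] at h
  rw [wordG, h]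
  have hext : ∀ j : Fin n, extFin κ j.val = κ j := fun j => by simp [extFin]
  rw [← Fin.prod_univ_eq_prod_range (fun i => wF q x
    (List.map (extFin κ) (List.range' (leftG G i) (i - leftG G i))) (extFin κ i)) n]
  have e2 : ∀ j : Fin n, wF q x (List.map (extFin κ)
      (List.range' (leftG G j) (j - leftG G j))) (extFin κ j) =
      x (κ j) * ∏ i : Fin n, (if G.Adj i j ∧ i < j then fW q (κ i) (κ j) else 1) := by
    intro j
    rw [wF, hext, List.map_map]
    congr 1
    have e3 : (List.map ((fun a => fW q a (κ j)) ∘ extFin κ)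
        (List.range' (leftG G j) (j - leftG G j))).prod =
        ∏ i ∈ Finset.Ico (leftG G j) j, fW q (extFin κ i) (κ j) := rfl
    rw [e3]
    have e4 : ∀ i : Fin n, (if G.Adj i j ∧ i < j then fW q (κ i) (κ j) else 1) =
        (fun t => if leftG G j ≤ t ∧ t < j.val then fW q (extFin κ t) (κ j) else 1) i.val := by
      intro i
      simp only [hext]
      by_cases hij : i < j
      · have := leftG_iff G hG i.val j.val hij
        have h2 : adjN G i.val j.val ↔ G.Adj i j := by simp [adjN]
        have h3 : i.val < j.val := hij
        rw [← h2, this]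
        simp [hij]
      · have h3 : ¬ i.val < j.val := hij
        simp [hij]
    simp only [e4]
    rw [Fin.prod_univ_eq_prod_range (fun t => if leftG G j ≤ t ∧ t < j.val then
      fW q (extFin κ t) (κ j) else 1) n, ← Finset.prod_filter]
    refine Finset.prod_congr ?_ fun _ _ => rfl
    ext t
    have := j.isLt
    simp only [Finset.mem_Ico, Finset.mem_filter, Finset.mem_range]
    omega
  rw [Finset.prod_congr rfl fun j _ => e2 j, Finset.prod_mul_distrib, colour_weight]
  split_ifs
  · ring
  · ring

end GraphWord

/-! ### Executable finite check -/

/-- A weight `q^b ∏[num] / ∏[den]`. -/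
structure Wt where
  b : ℕ
  num : List ℕ
  den : List ℕ

/-- Boolean membership. -/
def memB (i : ℕ) : List ℕ → Bool
  | [] => false
  | a :: l => (Nat.beq i a) || memB i l

/-- Erase the first occurrence. -/
def eraseB (i : ℕ) : List ℕ → List ℕ
  | [] => []
  | a :: l => bif Nat.beq i a then l else a :: eraseB i l

/-- Boolean equality of lists. -/
def eqB : List ℕ → List ℕ → Bool
  | [], [] => true
  | a :: l, b :: m => Nat.beq a b && eqB l m
  | [], _ :: _ => false
  | _ :: _, [] => false

/-- `(a \ b, b \ a)` as multisets. -/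
def splitB : List ℕ → List ℕ → List ℕ × List ℕ
  | [], m => ([], m)
  | a :: l, m => bif memB a m then splitB l (eraseB a m)
      else match splitB l m with
        | (x, y) => (a :: x, y)

def Wt.addNum (i : ℕ) : Wt → Wt
  | ⟨b, num, den⟩ =>
    bif memB i den then ⟨b, num, eraseB i den⟩ else ⟨b, i :: num, den⟩

def Wt.addDen (i : ℕ) : Wt → Wt
  | ⟨b, num, den⟩ =>
    bif memB i num then ⟨b, eraseB i num, den⟩ else ⟨b, num, i :: den⟩

def Wt.shift : Wt → Wt
  | ⟨b, num, den⟩ => ⟨b + 1, num, den⟩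

def Wt.stepFactor (c s : ℕ) (w : Wt) : Wt :=
  bif Nat.beq (s + 1) c then w
  else bif Nat.ble c s then Wt.shift (Wt.addDen (s + 1 - c) (Wt.addNum (s - c) w))
  else Wt.addDen (c - s - 1) (Wt.addNum (c - s) w)

def Wt.stepInit (c : ℕ) (w : Wt) : Wt :=
  bif Nat.beq c 1 then w else Wt.addDen (c - 1) (Wt.addNum c w)

def Wt.step (c : ℕ) (w : Wt) : List ℕ → Wt
  | [] => Wt.stepInit c w
  | s :: l => Wt.stepFactor c s (Wt.step c w l)

/-- A state of the finite search. -/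
structure St where
  win : List ℕ
  cols : List ℕ
  wt : Wt

def succNotIn (l : List ℕ) : List ℕ → List ℕ
  | [] => []
  | a :: m => bif memB (a + 1) l then succNotIn l m else (a + 1) :: succNotIn l m

/-- Candidate columns for the next vertex. -/
def cands (l : List ℕ) : List ℕ := succNotIn l (0 :: l)

def colCost : ℕ → ℕ
  | 0 => 0
  | 1 => 0
  | 2 => 2
  | _ + 3 => 1

def listCost : List ℕ → ℕ
  | [] => 0
  | a :: l => colCost a + listCost l

def insSorted (c : ℕ) : List ℕ → List ℕ
  | [] => [c]
  | a :: l => bif Nat.ble c a then c :: a :: l else a :: insSorted c l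

/-- Extend a state by the listed columns, pruning by cost. -/
def extend (l cols : List ℕ) (w : Wt) (acc : List St) : List ℕ → List St
  | [] => acc
  | c :: cs =>
    bif Nat.ble (colCost c + listCost cols) 6 then
      ⟨l ++ [c], insSorted c cols, Wt.step c w l⟩ :: extend l cols w acc cs
    else extend l cols w acc cs

def nodeNext (d : ℕ) : List St → List St
  | [] => []
  | s :: nd => extend (s.win.drop d) s.cols s.wt (nodeNext d nd) (cands (s.win.drop d))

/-! polynomials as coefficient lists -/
def pAdd : List ℕ → List ℕ → List ℕ
  | [], m => m
  | a :: l, [] => a :: l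
  | a :: l, b :: m => (a + b) :: pAdd l m

def pScale (a : ℕ) : List ℕ → List ℕ
  | [] => []
  | b :: l => (a * b) :: pScale a l

/-- Multiplication by `[i]`. -/
def pMulQ (m : List ℕ) : ℕ → List ℕ
  | 0 => []
  | i + 1 => pAdd m (0 :: pMulQ m i)

def pProd (m : List ℕ) : List ℕ → List ℕ
  | [] => m
  | i :: l => pMulQ (pProd m l) i

def pSub : List ℕ → List ℕ → List ℕ
  | [], _ => []
  | a :: l, [] => a :: l
  | a :: l, b :: m => (a - b) :: pSub l m

def pDiv (D : List ℕ) : ℕ → List ℕ → List ℕ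
  | 0, _ => []
  | _ + 1, [] => []
  | f + 1, a :: l => a :: pDiv D f (pSub l (pScale a D))

def pZero : List ℕ → Bool
  | [] => true
  | a :: l => Nat.beq a 0 && pZero l

def pEqv : List ℕ → List ℕ → Bool
  | [], m => pZero m
  | a :: l, [] => pZero (a :: l)
  | a :: l, b :: m => Nat.beq a b && pEqv l m

def pShift (m : List ℕ) : ℕ → List ℕ
  | 0 => m
  | b + 1 => 0 :: pShift m b

/-- Add a weight to a fraction. -/
def addFrac (w : Wt) (f : List ℕ × List ℕ) : List ℕ × List ℕ :=
  match splitB w.den f.2 with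
  | (x, y) => (pAdd (pProd f.1 x) (pShift (pProd (pProd [1] w.num) y) w.b), x ++ f.2)

def sumFrac (cols : List ℕ) : List St → List ℕ × List ℕ
  | [] => ([], [])
  | s :: nd => bif eqB s.cols cols then addFrac s.wt (sumFrac cols nd) else sumFrac cols nd

def others (cols : List ℕ) : List St → List St
  | [] => []
  | s :: nd => bif eqB s.cols cols then others cols nd else s :: others cols nd

def goodFrac (f : List ℕ × List ℕ) : Bool :=
  pEqv (pProd (pDiv (pProd [1] f.2).tail (f.1.length + 1 - (pProd [1] f.2).length) f.1) f.2) f.1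

def checkNode : ℕ → List St → Bool
  | _, [] => true
  | 0, _ :: _ => false
  | f + 1, s :: nd =>
    goodFrac (sumFrac s.cols (s :: nd)) && checkNode f (others s.cols nd)

/-- `test i` for all `i < k`. -/
def allBelow (test : ℕ → Bool) : ℕ → Bool
  | 0 => true
  | k + 1 => test k && allBelow test k

def checkTree : ℕ → ℕ → List St → Bool
  | _, _, [] => true
  | 0, _, _ :: _ => false
  | f + 1, k, s :: nd => checkNode 40 (s :: nd) &&
      allBelow (fun d => checkTree f (k - d + 1) (nodeNext d (s :: nd))) k

def startNode : List St := [⟨[1], [1], ⟨0, [], []⟩⟩]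


/-! ### The column polynomial -/

lemma memB_iff (i : ℕ) : ∀ l : List ℕ, memB i l = true ↔ i ∈ l
  | [] => by simp [memB]
  | a :: l => by
    rw [memB, Bool.or_eq_true, Nat.beq_eq, memB_iff i l, List.mem_cons]

lemma mem_succNotIn (l : List ℕ) (c : ℕ) : ∀ m : List ℕ,
    c ∈ succNotIn l m ↔ c ∉ l ∧ ∃ a ∈ m, a + 1 = c
  | [] => by simp [succNotIn]
  | a :: m => by
    have ih := mem_succNotIn l c m
    rw [succNotIn]
    by_cases h : memB (a + 1) l = true
    · have h' := (memB_iff _ _).1 h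
      rw [h, cond_true, ih]
      constructor
      · rintro ⟨h1, b, hb, h2⟩
        exact ⟨h1, b, List.mem_cons_of_mem _ hb, h2⟩
      · rintro ⟨h1, b, hb, h2⟩
        rcases List.mem_cons.1 hb with rfl | hb
        · exact absurd (h2 ▸ h') h1
        · exact ⟨h1, b, hb, h2⟩
    · have h' : a + 1 ∉ l := fun h2 => h ((memB_iff _ _).2 h2)
      rw [Bool.not_eq_true] at h
      rw [h, cond_false, List.mem_cons, ih]
      constructor
      · rintro (rfl | ⟨h1, b, hb, h2⟩)
        · exact ⟨h', a, List.mem_cons_self, rfl⟩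
        · exact ⟨h1, b, List.mem_cons_of_mem _ hb, h2⟩
      · rintro ⟨h1, b, hb, h2⟩
        rcases List.mem_cons.1 hb with rfl | hb
        · exact Or.inl h2.symm
        · exact Or.inr ⟨h1, b, hb, h2⟩

lemma nodup_succNotIn (l : List ℕ) : ∀ m : List ℕ, m.Nodup → (succNotIn l m).Nodup
  | [], _ => by simp [succNotIn]
  | a :: m, h => by
    have ih := nodup_succNotIn l m (List.nodup_cons.1 h).2
    rw [succNotIn]
    cases memB (a + 1) l
    · rw [cond_false, List.nodup_cons]
      refine ⟨fun h2 => ?_, ih⟩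
      obtain ⟨_, b, hb, h3⟩ := (mem_succNotIn l _ m).1 h2
      have : b = a := by omega
      exact (List.nodup_cons.1 h).1 (this ▸ hb)
    · exact ih

section ColPoly

variable {k : Type*} [Field k] {N : ℕ}

/-- Weight of adding a column (indexed from one). -/
noncomputable def wB (q : k) (l : List ℕ) (c : ℕ) : k :=
  (if c = 1 then 1 else br q c / br q (c - 1)) * (l.map fun s => hB q c s).prod

/-- Variable of a column. -/
noncomputable def yv (k : Type*) [Field k] (N : ℕ) (c : ℕ) : MvPolynomial (Fin N) k :=
  if h : 1 ≤ c ∧ c ≤ N then X ⟨c - 1, by omega⟩ else 0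

/-- The generating polynomial of column sequences. -/
noncomputable def ppoly (N : ℕ) (q : k) : List ℕ → List ℕ → MvPolynomial (Fin N) k
  | [], _ => 1
  | d :: ds, l => ((cands (l.drop d)).map fun c =>
      MvPolynomial.C (wB q (l.drop d) c) * yv k N c * ppoly N q ds (l.drop d ++ [c])).sum

lemma hB_succ (q : k) (c s : ℕ) : hB q (c + 1) (s + 1) = hB q c s := by
  unfold hB
  have e1 : s + 1 - (c + 1) = s - c := by omega
  have e2 : s + 1 + 1 - (c + 1) = s + 1 - c := by omega
  have e3 : c + 1 - (s + 1) = c - s := by omega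
  have e4 : c + 1 - (s + 1) - 1 = c - s - 1 := by omega
  rw [e1, e2, e3]
  simp only [Nat.add_right_cancel_iff, Nat.add_le_add_iff_right]

variable {K : Type*} [Field K] [Algebra k K]

lemma br_map (q : k) (n : ℕ) : algebraMap k K (br q n) = br (algebraMap k K q) n := by
  simp [br]

lemma hB_map (q : k) (c s : ℕ) : algebraMap k K (hB q c s) = hB (algebraMap k K q) c s := by
  unfold hB
  split_ifs <;> simp [br_map]

/-- The column steps. -/
noncomputable def fC (x : Fin N → K) (c : Fin N) : K := eC x (c.val + 1) / eC x c.val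

theorem bval_eq_ppoly (q : k) (hq0 : q ≠ 0) (hq : ∀ n, 1 ≤ n → q ^ n ≠ 1) (x : Fin N → K)
    (ds : List ℕ) : ∀ l : List (Fin N), l.Nodup →
    bval (wP (algebraMap k K q) (fun i => (algebraMap k K q)⁻¹ ^ i) (gB (algebraMap k K q) x)) ds l =
      aeval (fC x) (ppoly N q ds (l.map fun c => c.val + 1)) := by
  have hq0' : algebraMap k K q ≠ 0 := by simpa using hq0
  have hq' : ∀ n, 1 ≤ n → (algebraMap k K q) ^ n ≠ 1 := by
    intro n hn h
    rw [← map_pow, map_eq_one_iff _ (algebraMap k K).injective] at h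
    exact hq n hn h
  induction ds with
  | nil => intro l _; simp [bval, ppoly]
  | cons d ds ih =>
    intro l hl
    rw [bval, ppoly, ← List.map_drop]
    have hl' : (l.drop d).Nodup := hl.sublist (List.drop_sublist _ _)
    generalize l.drop d = l at hl'
    have hinj : Function.Injective fun c : Fin N => c.val + 1 := fun a b h => Fin.ext (by
      simp only at h; omega)
    have hn1 : (l.map fun c : Fin N => c.val + 1).Nodup := hl'.map hinj
    have hnd : (cands (l.map fun c : Fin N => c.val + 1)).Nodup := by
      refine nodup_succNotIn _ _ (List.nodup_cons.2 ⟨?_, hn1⟩)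
      simp
    rw [← List.sum_toFinset _ hnd, map_sum]
    have key : ∀ c : Fin N, wP (algebraMap k K q) (fun i => (algebraMap k K q)⁻¹ ^ i)
        (gB (algebraMap k K q) x) l c * bval (wP (algebraMap k K q)
          (fun i => (algebraMap k K q)⁻¹ ^ i) (gB (algebraMap k K q) x)) ds (l ++ [c]) =
        if c.val + 1 ∈ cands (l.map fun c => c.val + 1) then
          aeval (fC x) (MvPolynomial.C (wB q (l.map fun c => c.val + 1) (c.val + 1)) *
            yv k N (c.val + 1) * ppoly N q ds ((l.map fun c => c.val + 1) ++ [c.val + 1])) else 0 := by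
      intro c
      have hmem : c.val + 1 ∈ cands (l.map fun c => c.val + 1) ↔
          c ∉ l ∧ (c.val = 0 ∨ ∃ a ∈ l, a.val + 1 = c.val) := by
        rw [cands, mem_succNotIn]
        constructor
        · rintro ⟨h1, a, h2, h3⟩
          refine ⟨fun h => h1 (List.mem_map.2 ⟨c, h, rfl⟩), ?_⟩
          rcases List.mem_cons.1 h2 with h2 | h2
          · left; omega
          · obtain ⟨b, hb, h4⟩ := List.mem_map.1 h2
            right; exact ⟨b, hb, by omega⟩
        · rintro ⟨h1, h2⟩
          refine ⟨fun h => ?_, ?_⟩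
          · obtain ⟨b, hb, h4⟩ := List.mem_map.1 h
            exact h1 (hinj h4 ▸ hb)
          · rcases h2 with h2 | ⟨a, ha, h2⟩
            · exact ⟨0, List.mem_cons_self, by omega⟩
            · exact ⟨a.val + 1, List.mem_cons_of_mem _ (List.mem_map.2 ⟨a, ha, rfl⟩), by omega⟩
      by_cases hc : c ∈ l
      · rw [if_neg fun h => (hmem.1 h).1 hc]
        have : (0 : K) ∈ l.map fun s => hP (algebraMap k K q)
            (fun i => (algebraMap k K q)⁻¹ ^ i) c.val s.val :=
          List.mem_map.2 ⟨c, hc, hP_self _ _ _⟩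
        rw [wP, List.prod_eq_zero this]; simp
      by_cases hi : c.val = 0 ∨ ∃ a ∈ l, a.val + 1 = c.val
      · rw [if_pos (hmem.2 ⟨hc, hi⟩), ih (l ++ [c]) (by
          rw [List.nodup_append]; simp [hl', hc]
          intro a ha h; exact hc (h ▸ ha))]
        rw [map_mul, map_mul]
        simp only [List.map_append, List.map_cons, List.map_nil]
        congr 1
        have hy : yv k N (c.val + 1) = X c := by
          have := c.isLt
          rw [yv, dif_pos ⟨by omega, by omega⟩]; rfl
        rw [hy, aeval_X, MvPolynomial.algHom_C, wP, iP, if_pos hi, gB, wB, map_mul,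
          map_list_prod, List.map_map, List.map_map]
        have e1 : (l.map ((fun s => algebraMap k K (hB q (c.val + 1) s)) ∘ fun c : Fin N => c.val + 1)) =
            l.map fun s => hP (algebraMap k K q) (fun i => (algebraMap k K q)⁻¹ ^ i) c.val s.val := by
          refine List.map_congr_left fun s _ => ?_
          simp only [Function.comp_apply]
          rw [hB_succ, hB_map, hP_eq _ hq0' hq']
        have e2 : algebraMap k K (if c.val + 1 = 1 then 1 else br q (c.val + 1) / br q (c.val + 1 - 1)) =
            (if c.val = 0 then 1 else br (algebraMap k K q) (c.val + 1) / br (algebraMap k K q) c.val) := by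
          by_cases h0 : c.val = 0
          · simp [h0]
          · simp [h0, br_map]
        rw [e2]
        rw [← e1, fC]
        have e3 : ((⇑(algebraMap k K) ∘ (fun s => hB q (c.val + 1) s)) ∘ fun c : Fin N => c.val + 1) =
          ((fun s => algebraMap k K (hB q (c.val + 1) s)) ∘ fun c : Fin N => c.val + 1) := rfl
        rw [e3]
        ring
      · rw [if_neg fun h => hi (hmem.1 h).2, wP, iP, if_neg hi]; simp
    rw [Finset.sum_congr rfl fun c _ => key c, ← Finset.sum_filter]
    rw [← Finset.sum_subset (s₁ := (Finset.univ.filter fun c : Fin N =>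
      c.val + 1 ∈ cands (l.map fun c => c.val + 1)).image fun c : Fin N => c.val + 1)
      (s₂ := (cands (l.map fun c : Fin N => c.val + 1)).toFinset)]
    · rw [Finset.sum_image fun a _ b _ h => hinj h]
    · intro c hc
      obtain ⟨a, ha, rfl⟩ := Finset.mem_image.1 hc
      exact List.mem_toFinset.2 (Finset.mem_filter.1 ha).2
    · intro c hc hc'
      have h0 : yv k N c = 0 := by
        rw [yv, dif_neg]
        rintro ⟨h1, h2⟩
        apply hc'
        refine Finset.mem_image.2 ⟨⟨c - 1, by omega⟩, Finset.mem_filter.2 ⟨Finset.mem_univ _, ?_⟩, ?_⟩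
        · have : c - 1 + 1 = c := by omega
          simp only [this]
          exact List.mem_toFinset.1 hc
        · simp only; omega
      rw [h0]; simp

end ColPoly

/-! ### Independence of the column steps -/

section Indep

variable {k : Type} [Field k] {N : ℕ}

lemma eC_formula {K : Type*} [Field K] (x : Fin N → K) (c : ℕ) :
    eC x c = ∑ t ∈ Finset.powersetCard c Finset.univ, ∏ i ∈ t, x i := by
  unfold eC genH
  simp only [Nat.not_lt_zero, if_false]
  rw [Finset.prod_one_add, Polynomial.finsetSum_coeff]
  have : ∀ t : Finset (Fin N), (∏ i ∈ t, (Polynomial.C (x i) * Polynomial.X)).coeff c =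
      if c = t.card then ∏ i ∈ t, x i else 0 := by
    intro t
    rw [Finset.prod_mul_distrib, Finset.prod_const, ← map_prod, Polynomial.coeff_C_mul_X_pow]
  simp only [this]
  rw [← Finset.sum_filter]
  refine Finset.sum_congr ?_ fun _ _ => rfl
  ext t
  simp [Finset.mem_powersetCard, eq_comm]

/-- The generic point. -/
noncomputable def xg (k : Type) [Field k] (N : ℕ) (i : Fin N) : FractionRing (MvPolynomial (Fin N) k) :=
  algebraMap (MvPolynomial (Fin N) k) _ (X i)

lemma eC_xg (c : ℕ) : eC (xg k N) c = algebraMap (MvPolynomial (Fin N) k) _ (esymm (Fin N) k c) := by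
  rw [eC_formula, esymm, map_sum]
  simp only [map_prod, xg]

lemma aeval_esymm_inj : Function.Injective
    (aeval (fun i : Fin N => eC (xg k N) (i.val + 1)) :
      MvPolynomial (Fin N) k →ₐ[k] FractionRing (MvPolynomial (Fin N) k)) := by
  have h := esymmAlgHom_fin_injective (n := N) (m := N) k le_rfl
  have h2 : Function.Injective (algebraMap (MvPolynomial (Fin N) k)
    (FractionRing (MvPolynomial (Fin N) k))) := IsFractionRing.injective _ _
  have e : (aeval (fun i : Fin N => eC (xg k N) (i.val + 1)) :
      MvPolynomial (Fin N) k →ₐ[k] FractionRing (MvPolynomial (Fin N) k)) =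
      ((IsScalarTower.toAlgHom k (MvPolynomial (Fin N) k) (FractionRing (MvPolynomial (Fin N) k))).comp
        (symmetricSubalgebra (Fin N) k).val).comp (esymmAlgHom (Fin N) k N) := by
    apply MvPolynomial.algHom_ext
    intro i
    simp [esymmAlgHom, eC_xg]
  rw [e]
  intro a b hab
  exact h (Subtype.ext (h2 hab))

lemma eC_xg_ne (c : ℕ) (hc : c ≤ N) : eC (xg k N) c ≠ 0 := by
  rcases Nat.eq_zero_or_pos c with rfl | h0
  · rw [eC_zero]; exact one_ne_zero
  · intro h
    have := @aeval_esymm_inj k _ N (X ⟨c - 1, by omega⟩) 0 (by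
      rw [aeval_X, map_zero]
      have : c - 1 + 1 = c := by omega
      simp only [this, h])
    exact MvPolynomial.X_ne_zero _ this

/-- Products of column variables. -/
noncomputable def thetaH (k : Type) [Field k] (N : ℕ) : MvPolynomial (Fin N) k →ₐ[k] MvPolynomial (Fin N) k :=
  aeval fun i : Fin N => ∏ j ∈ Finset.univ.filter (fun j : Fin N => j.val < i.val + 1), X j

lemma prod_fC (c : ℕ) (hc : c ≤ N) :
    ∏ j ∈ Finset.univ.filter (fun j : Fin N => j.val < c), fC (xg k N) j = eC (xg k N) c := by
  induction c with
  | zero => simp [eC_zero]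
  | succ c ih =>
    have : Finset.univ.filter (fun j : Fin N => j.val < c + 1) =
        insert (⟨c, by omega⟩ : Fin N) (Finset.univ.filter (fun j : Fin N => j.val < c)) := by
      ext j
      simp only [Finset.mem_filter, Finset.mem_univ, true_and, Finset.mem_insert, Fin.ext_iff]
      omega
    rw [this, Finset.prod_insert (by simp), ih (by omega), fC]
    exact div_mul_cancel₀ _ (eC_xg_ne c (by omega))

lemma aeval_thetaH (P : MvPolynomial (Fin N) k) :
    aeval (fC (xg k N)) (thetaH k N P) = aeval (fun i : Fin N => eC (xg k N) (i.val + 1)) P := by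
  rw [← AlgHom.comp_apply]
  congr 1
  apply MvPolynomial.algHom_ext
  intro i
  rw [AlgHom.comp_apply, thetaH, aeval_X, aeval_X, map_prod]
  simp only [aeval_X]
  exact prod_fC _ (by omega)

lemma thetaH_denom (P : MvPolynomial (Fin N) k) :
    ∃ W Q : MvPolynomial (Fin N) k, W ≠ 0 ∧ P * thetaH k N W = thetaH k N Q := by
  induction P using MvPolynomial.induction_on with
  | C a => exact ⟨1, MvPolynomial.C a, one_ne_zero, by
      rw [map_one, mul_one, MvPolynomial.algHom_C]; rfl⟩
  | add P1 P2 h1 h2 =>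
    obtain ⟨W1, Q1, a1, b1⟩ := h1
    obtain ⟨W2, Q2, a2, b2⟩ := h2
    refine ⟨W1 * W2, Q1 * W2 + Q2 * W1, mul_ne_zero a1 a2, ?_⟩
    rw [map_mul, map_add, map_mul, map_mul, ← b1, ← b2]; ring
  | mul_X P i h =>
    obtain ⟨W1, Q1, a1, b1⟩ := h
    have hX : ∃ W : MvPolynomial (Fin N) k, W ≠ 0 ∧ X i * thetaH k N W = thetaH k N (X i) := by
      have hs : Finset.univ.filter (fun j : Fin N => j.val < i.val + 1) =
          insert i (Finset.univ.filter (fun j : Fin N => j.val < i.val)) := by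
        ext j
        simp only [Finset.mem_filter, Finset.mem_univ, true_and, Finset.mem_insert, Fin.ext_iff]
        omega
      have e : thetaH k N (X i) =
          X i * ∏ j ∈ Finset.univ.filter (fun j : Fin N => j.val < i.val), X j := by
        rw [thetaH, aeval_X, hs, Finset.prod_insert (by simp)]
      rcases Nat.eq_zero_or_pos i.val with h0 | h0
      · refine ⟨1, one_ne_zero, ?_⟩
        rw [e, h0]; simp
      · refine ⟨X ⟨i.val - 1, by omega⟩, MvPolynomial.X_ne_zero _, ?_⟩
        rw [e, thetaH, aeval_X]
        have : i.val - 1 + 1 = i.val := by omega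
        simp only [this]
    obtain ⟨W, a2, b2⟩ := hX
    refine ⟨W1 * W, Q1 * X i, mul_ne_zero a1 a2, ?_⟩
    rw [map_mul, map_mul, ← b1, ← b2]; ring

lemma aeval_fC_inj : Function.Injective
    (aeval (fC (xg k N)) : MvPolynomial (Fin N) k →ₐ[k] FractionRing (MvPolynomial (Fin N) k)) := by
  rw [injective_iff_map_eq_zero]
  intro P hP
  obtain ⟨W, Q, hW, h⟩ := thetaH_denom P
  have hW' : thetaH k N W ≠ 0 := by
    intro h0
    have := aeval_thetaH W
    rw [h0, map_zero] at this
    exact hW (aeval_esymm_inj (by rw [← this, map_zero]))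
  have h2 := congrArg (aeval (fC (xg k N))) h
  rw [map_mul, hP, zero_mul, aeval_thetaH] at h2
  have h3 : Q = 0 := aeval_esymm_inj (by rw [← h2, map_zero])
  rw [h3, map_zero] at h
  exact (mul_eq_zero.1 h).resolve_right hW'

/-- Exponent vector of `e_a` in the column steps. -/
noncomputable def expo1 (N a : ℕ) : Fin N →₀ ℕ :=
  Finsupp.equivFunOnFinite.symm fun i => if i.val < a then 1 else 0

/-- Exponent vector of `e_λ`. -/
noncomputable def expo (N : ℕ) {n : ℕ} (p : Nat.Partition n) : Fin N →₀ ℕ := (p.parts.map (expo1 N)).sum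

lemma aeval_expo1 (a : ℕ) (ha : a ≤ N) :
    aeval (fC (xg k N)) (monomial (expo1 N a) (1 : k)) = eC (xg k N) a := by
  rw [aeval_monomial, map_one, one_mul, Finsupp.prod_fintype _ _ (by simp), ← prod_fC a ha,
    Finset.prod_filter]
  refine Finset.prod_congr rfl fun i _ => ?_
  simp only [expo1, Finsupp.equivFunOnFinite_symm_apply_apply]
  split_ifs <;> simp

lemma part_le {n : ℕ} (p : Nat.Partition n) {a : ℕ} (ha : a ∈ p.parts) : a ≤ n := by
  have := Multiset.single_le_sum (fun _ _ => Nat.zero_le _) a ha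
  rwa [p.parts_sum] at this

lemma aeval_expo {n : ℕ} (hn : n ≤ N) (p : Nat.Partition n) :
    aeval (fC (xg k N)) (monomial (expo N p) (1 : k)) =
      algebraMap (MvPolynomial (Fin N) k) _ (eProd N k p) := by
  have key : ∀ s : Multiset ℕ, (∀ a ∈ s, a ≤ N) →
      aeval (fC (xg k N)) (monomial (s.map (expo1 N)).sum (1 : k)) =
      algebraMap (MvPolynomial (Fin N) k) _ (s.map fun a => esymm (Fin N) k a).prod := by
    intro s
    induction s using Multiset.induction_on with
    | empty => intro _; simp
    | cons a s ih =>
      intro h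
      rw [Multiset.map_cons, Multiset.sum_cons, Multiset.map_cons, Multiset.prod_cons, map_mul,
        ← ih fun b hb => h b (Multiset.mem_cons_of_mem hb), ← eC_xg,
        ← aeval_expo1 a (h a (Multiset.mem_cons_self a s)), ← map_mul, monomial_mul, one_mul]
  exact key _ fun a ha => (part_le p ha).trans hn

lemma expo_apply {n : ℕ} (p : Nat.Partition n) (i : Fin N) :
    expo N p i = (p.parts.filter fun a => i.val < a).card := by
  unfold expo
  induction p.parts using Multiset.induction_on with
  | empty => simp
  | cons a s ih =>
    rw [Multiset.map_cons, Multiset.sum_cons, Finsupp.add_apply, ih]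
    by_cases h : i.val < a
    · rw [Multiset.filter_cons_of_pos _ h, Multiset.card_cons]
      have : expo1 N a i = 1 := by simp [expo1, h]
      rw [this]; exact Nat.add_comm _ _
    · rw [Multiset.filter_cons_of_neg _ h]
      simp [expo1, h]

lemma card_filter_split (s : Multiset ℕ) (a : ℕ) :
    (s.filter fun b => a < b).card + s.count a = (s.filter fun b => a ≤ b).card := by
  induction s using Multiset.induction_on with
  | empty => simp
  | cons b s ih =>
    simp only [Multiset.filter_cons, Multiset.count_cons, Multiset.card_add]
    rcases lt_trichotomy a b with h | h | h
    · have h1 : a ≤ b := h.le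
      have h2 : a ≠ b := h.ne
      simp [h, h1, h2]; omega
    · subst h; simp; omega
    · have h1 : ¬ a ≤ b := by omega
      have h2 : ¬ a < b := by omega
      have h3 : a ≠ b := by omega
      simp [h1, h2, h3]; omega

lemma expo_inj {n : ℕ} (hn : n ≤ N) (p p' : Nat.Partition n) (h : expo N p = expo N p') : p = p' := by
  have h1 : ∀ a, 1 ≤ a → (p.parts.filter fun b => a ≤ b).card = (p'.parts.filter fun b => a ≤ b).card := by
    intro a ha
    by_cases haN : a ≤ N
    · have := congrArg (fun f => f ⟨a - 1, by omega⟩) h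
      simp only [expo_apply] at this
      have e : ∀ b, a - 1 < b ↔ a ≤ b := by intro b; omega
      simpa only [e] using this
    · have e : ∀ p : Nat.Partition n, (p.parts.filter fun b => a ≤ b) = 0 := by
        intro p
        rw [Multiset.filter_eq_nil]
        intro b hb
        have := part_le p hb
        omega
      rw [e, e]
  ext a
  rcases Nat.eq_zero_or_pos a with rfl | ha
  · rw [Multiset.count_eq_zero.2, Multiset.count_eq_zero.2]
    · intro h0; exact absurd (p'.parts_pos h0) (by omega)
    · intro h0; exact absurd (p.parts_pos h0) (by omega)
  · have a1 := card_filter_split p.parts a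
    have a2 := card_filter_split p'.parts a
    have a3 := h1 a ha
    have a4 := h1 (a + 1) (by omega)
    simp only [Nat.succ_le_iff] at a4
    omega

/-- The chromatic polynomial with a specialised parameter. -/
noncomputable def chromK (n N : ℕ) (G : SimpleGraph (Fin n)) (q : k) : MvPolynomial (Fin N) k :=
  ∑ κ : Fin n → Fin N, if IsProper G κ then MvPolynomial.C (q ^ ascNum G κ) * ∏ i, X (κ i) else 0

lemma chromK_eq {n : ℕ} (hn : n ≤ N) (G : SimpleGraph (Fin n)) (hG : IsNUIG G) (q : k)
    (hq0 : q ≠ 0) (hq : ∀ n, 1 ≤ n → q ^ n ≠ 1) :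
    algebraMap (MvPolynomial (Fin N) k) (FractionRing (MvPolynomial (Fin N) k)) (chromK n N G q) =
      aeval (fC (xg k N)) (ppoly N q (wordG G) []) := by
  rcases Nat.eq_zero_or_pos N with hN | hN
  · subst hN
    obtain rfl : n = 0 := by omega
    have hp : IsProper G (fun i : Fin 0 => i.elim0 : Fin 0 → Fin 0) := fun i => i.elim0
    simp [chromK, wordG, dsFrom, ppoly, ascNum, IsProper]
  · have : Inhabited (Fin N) := ⟨⟨0, hN⟩⟩
    have h1 := bval_eq_ppoly (K := FractionRing (MvPolynomial (Fin N) k)) q hq0 hq (xg k N) (wordG G) []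
      List.nodup_nil
    rw [List.map_nil] at h1
    rw [← h1, ← colour_eq_column _ _ _ (xg k N) (fun c hc => eC_xg_ne c hc) _ (wordG_legal G hG),
      bval_wordG G hG, chromK, map_sum]
    · refine Finset.sum_congr rfl fun κ _ => ?_
      split_ifs
      · rw [map_mul, map_prod, IsScalarTower.algebraMap_apply k (MvPolynomial (Fin N) k)
          (FractionRing (MvPolynomial (Fin N) k)) q, ← map_pow, MvPolynomial.algebraMap_eq, map_pow MvPolynomial.C]
        rfl
      · rw [map_zero]
    · simpa using hq0
    · intro m hm h
      rw [← map_pow, map_eq_one_iff _ (algebraMap k _).injective] at h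
      exact hq m hm h

theorem coeff_ppoly {n : ℕ} (hn : n ≤ N) (G : SimpleGraph (Fin n)) (hG : IsNUIG G) (q : k)
    (hq0 : q ≠ 0) (hq : ∀ n, 1 ≤ n → q ^ n ≠ 1) (c : Nat.Partition n → k)
    (h : chromK n N G q = ∑ p : Nat.Partition n, MvPolynomial.C (c p) * eProd N k p) (p : Nat.Partition n) :
    MvPolynomial.coeff (expo N p) (ppoly N q (wordG G) []) = c p := by
  have h1 := chromK_eq hn G hG q hq0 hq
  have h2 : aeval (fC (xg k N)) (∑ p : Nat.Partition n, monomial (expo N p) (c p)) =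
      algebraMap (MvPolynomial (Fin N) k) (FractionRing (MvPolynomial (Fin N) k)) (chromK n N G q) := by
    rw [h, map_sum, map_sum]
    refine Finset.sum_congr rfl fun p _ => ?_
    have : monomial (expo N p) (c p) = MvPolynomial.C (c p) * monomial (expo N p) (1 : k) := by
      rw [C_mul_monomial, mul_one]
    rw [this, map_mul, map_mul, aeval_expo hn, MvPolynomial.algHom_C, ← MvPolynomial.algebraMap_eq,
      ← IsScalarTower.algebraMap_apply]
  rw [h1] at h2
  rw [← aeval_fC_inj h2, coeff_sum, Finset.sum_eq_single p]
  · rw [coeff_monomial, if_pos rfl]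
  · intro p' _ hp'
    rw [coeff_monomial, if_neg fun h => hp' (expo_inj hn _ _ h)]
  · simp

end Indep

/-! ### Polynomials with good coefficients, and the second part -/

section GoodPoly

variable {k : Type} [Field k] {N : ℕ}

/-- All coefficients of small cost lie in `S`. -/
def GoodP (S : Subsemiring k) (cst : (Fin N →₀ ℕ) →+ ℕ) (W : ℕ) (P : MvPolynomial (Fin N) k) : Prop :=
  ∀ m, cst m ≤ W → MvPolynomial.coeff m P ∈ S

variable {S : Subsemiring k} {cst : (Fin N →₀ ℕ) →+ ℕ} {W : ℕ}

lemma GoodP.zero : GoodP S cst W 0 := fun m _ => by rw [coeff_zero]; exact S.zero_mem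

lemma GoodP.add {P Q : MvPolynomial (Fin N) k} (hP : GoodP S cst W P) (hQ : GoodP S cst W Q) :
    GoodP S cst W (P + Q) := fun m hm => by
  rw [coeff_add]; exact S.add_mem (hP m hm) (hQ m hm)

lemma GoodP.mul {P Q : MvPolynomial (Fin N) k} (hP : GoodP S cst W P) (hQ : GoodP S cst W Q) :
    GoodP S cst W (P * Q) := fun m hm => by
  rw [coeff_mul]
  refine S.sum_mem fun x hx => ?_
  have h := Finset.HasAntidiagonal.mem_antidiagonal.1 hx
  have h2 : cst x.1 + cst x.2 = cst m := by rw [← h, map_add]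
  exact S.mul_mem (hP _ (by omega)) (hQ _ (by omega))

lemma GoodP.C {a : k} (ha : a ∈ S) : GoodP S cst W (MvPolynomial.C a) := fun m hm => by
  rw [coeff_C]
  split_ifs
  · exact ha
  · exact S.zero_mem

lemma GoodP.one : GoodP S cst W (1 : MvPolynomial (Fin N) k) := GoodP.C S.one_mem

lemma GoodP.X (i : Fin N) : GoodP S cst W (MvPolynomial.X i) := fun m hm => by
  rw [coeff_X]
  split_ifs
  · exact S.one_mem
  · exact S.zero_mem

lemma GoodP.yv (c : ℕ) : GoodP S cst W (yv k N c) := by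
  rw [_root_.yv]
  split_ifs
  · exact GoodP.X _
  · exact GoodP.zero

lemma GoodP.list_sum (l : List (MvPolynomial (Fin N) k)) (h : ∀ P ∈ l, GoodP S cst W P) :
    GoodP S cst W l.sum := by
  induction l with
  | nil => exact GoodP.zero
  | cons P l ih =>
    rw [List.sum_cons]
    exact (h P List.mem_cons_self).add (ih fun Q hQ => h Q (List.mem_cons_of_mem _ hQ))

lemma GoodP.ppoly_of_weights (q : k) (hw : ∀ l c, wB q l c ∈ S) (ds : List ℕ) :
    ∀ l, GoodP S cst W (ppoly N q ds l) := by
  induction ds with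
  | nil => intro l; exact GoodP.one
  | cons d ds ih =>
    intro l
    refine GoodP.list_sum _ fun P hP => ?_
    obtain ⟨c, _, rfl⟩ := List.mem_map.1 hP
    exact ((GoodP.C (hw _ _)).mul (GoodP.yv c)).mul (ih _)

end GoodPoly

lemma br_nonneg {q : ℝ} (hq : 0 ≤ q) (n : ℕ) : 0 ≤ br q n :=
  Finset.sum_nonneg fun i _ => pow_nonneg hq i

lemma hB_nonneg {q : ℝ} (hq : 0 ≤ q) (c s : ℕ) : 0 ≤ hB q c s := by
  unfold hB
  split_ifs
  · exact zero_le_one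
  · exact div_nonneg (mul_nonneg hq (br_nonneg hq _)) (br_nonneg hq _)
  · exact div_nonneg (br_nonneg hq _) (br_nonneg hq _)

lemma wB_nonneg {q : ℝ} (hq : 0 ≤ q) (l : List ℕ) (c : ℕ) : 0 ≤ wB q l c := by
  unfold wB
  refine mul_nonneg ?_ (List.prod_nonneg ?_)
  · split_ifs
    · exact zero_le_one
    · exact div_nonneg (br_nonneg hq _) (br_nonneg hq _)
  · intro a ha
    obtain ⟨s, _, rfl⟩ := List.mem_map.1 ha
    exact hB_nonneg hq c s

lemma ppoly_nonneg {N : ℕ} {q : ℝ} (hq : 0 ≤ q) (ds l : List ℕ) (m : Fin N →₀ ℕ) :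
    0 ≤ MvPolynomial.coeff m (ppoly N q ds l) := by
  have := GoodP.ppoly_of_weights (S := Subsemiring.nonneg ℝ) (cst := 0) (W := 0) (N := N) q
    (fun l c => wB_nonneg hq l c) ds l m le_rfl
  exact this

theorem second_part (n N : ℕ) (hN : n ≤ N) (p : Nat.Partition n) (G : SimpleGraph (Fin n))
    (hG : IsNUIG G) (c : Nat.Partition n → ℤ)
    (h : chromSym n N G = ∑ q : Nat.Partition n, MvPolynomial.C (c q) * eProd N ℤ q) : 0 ≤ c p := by
  obtain ⟨g, hg⟩ := LinearMap.exists_leftInverse_of_injective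
    (aeval (fC (xg ℝ N)) : MvPolynomial (Fin N) ℝ →ₐ[ℝ] FractionRing (MvPolynomial (Fin N) ℝ)).toLinearMap
    (LinearMap.ker_eq_bot.2 aeval_fC_inj)
  let ι : MvPolynomial (Fin N) ℝ →ₗ[ℝ] FractionRing (MvPolynomial (Fin N) ℝ) :=
    (IsScalarTower.toAlgHom ℝ (MvPolynomial (Fin N) ℝ) (FractionRing (MvPolynomial (Fin N) ℝ))).toLinearMap
  let ℓ : MvPolynomial (Fin N) ℝ →ₗ[ℝ] ℝ := (MvPolynomial.lcoeff ℝ (expo N p)) ∘ₗ g ∘ₗ ι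
  have hg' : ∀ P, g (aeval (fC (xg ℝ N)) P) = P := fun P => LinearMap.congr_fun hg P
  have h1 : ∀ q : ℝ, 1 < q → 0 ≤ ℓ (chromK n N G q) := by
    intro q hq
    have e : ι (chromK n N G q) = aeval (fC (xg ℝ N)) (ppoly N q (wordG G) []) :=
      chromK_eq hN G hG q (by linarith) (fun m hm h => by
        have := one_lt_pow₀ hq (show m ≠ 0 by omega)
        linarith)
    have e2 : ℓ (chromK n N G q) = MvPolynomial.coeff (expo N p) (ppoly N q (wordG G) []) := by
      simp only [ℓ, LinearMap.comp_apply, e, hg', MvPolynomial.lcoeff_apply]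
    rw [e2]
    exact ppoly_nonneg (by linarith) _ _ _
  have h2 : Continuous fun q : ℝ => ℓ (chromK n N G q) := by
    have : (fun q : ℝ => ℓ (chromK n N G q)) = fun q => ∑ κ : Fin n → Fin N,
        q ^ ascNum G κ * ℓ (if IsProper G κ then ∏ i, MvPolynomial.X (κ i) else 0) := by
      funext q
      rw [chromK, map_sum]
      refine Finset.sum_congr rfl fun κ _ => ?_
      split_ifs
      · rw [← smul_eq_C_mul, map_smul, smul_eq_mul]
      · rw [map_zero, mul_zero]
    rw [this]
    fun_prop
  have h3 : 0 ≤ ℓ (chromK n N G 1) := by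
    refine ge_of_tendsto ((h2.tendsto 1).mono_left (nhdsWithin_le_nhds (s := Set.Ioi 1))) ?_
    filter_upwards [self_mem_nhdsWithin] with q hq using h1 q hq
  have h4 : chromK n N G (1 : ℝ) = ∑ q : Nat.Partition n, MvPolynomial.C ((c q : ℤ) : ℝ) * eProd N ℝ q := by
    have h5 := congrArg (MvPolynomial.map (Int.castRingHom ℝ)) h
    have e1 : MvPolynomial.map (Int.castRingHom ℝ) (chromSym n N G) = chromK n N G (1 : ℝ) := by
      rw [chromSym, chromK, map_sum]
      refine Finset.sum_congr rfl fun κ _ => ?_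
      split_ifs <;> simp
    rw [← e1, h5, map_sum]
    refine Finset.sum_congr rfl fun q _ => ?_
    rw [map_mul, map_C, eProd, eProd, map_multiset_prod, Multiset.map_map]
    simp [Function.comp_def, map_esymm]
  have h6 : ℓ (chromK n N G 1) = c p := by
    have e : ∀ q : Nat.Partition n, ℓ (eProd N ℝ q) = if q = p then 1 else 0 := by
      intro q
      have : ι (eProd N ℝ q) = aeval (fC (xg ℝ N)) (monomial (expo N q) (1 : ℝ)) := (aeval_expo hN q).symm
      simp only [ℓ, LinearMap.comp_apply, this, hg', MvPolynomial.lcoeff_apply, coeff_monomial]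
      by_cases hqp : q = p
      · simp [hqp]
      · rw [if_neg hqp, if_neg fun h => hqp (expo_inj hN _ _ h)]
    rw [h4, map_sum]
    simp only [← smul_eq_C_mul, map_smul, e]
    simp
  rw [h6] at h3
  exact_mod_cast h3

/-! ### Soundness of the finite check -/

lemma eqB_iff : ∀ l m : List ℕ, eqB l m = true → l = m
  | [], [] => fun _ => rfl
  | a :: l, b :: m => fun h => by
    rw [eqB, Bool.and_eq_true, Nat.beq_eq] at h
    rw [h.1, eqB_iff l m h.2]
  | [], _ :: _ => fun h => by simp [eqB] at h
  | _ :: _, [] => fun h => by simp [eqB] at h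

section Sound

variable {k : Type} [Field k] (q : k)

/-- Product of `q`-integers. -/
noncomputable def dv (l : List ℕ) : k := (l.map (br q)).prod

lemma dv_nil : dv q [] = 1 := rfl

lemma dv_cons (a : ℕ) (l : List ℕ) : dv q (a :: l) = br q a * dv q l := by simp [dv]

lemma dv_append (l m : List ℕ) : dv q (l ++ m) = dv q l * dv q m := by simp [dv]

lemma dv_erase (i : ℕ) : ∀ l : List ℕ, memB i l = true → br q i * dv q (eraseB i l) = dv q l
  | [], h => by simp [memB] at h
  | a :: l, h => by
    rw [eraseB, dv_cons]
    rcases hb : Nat.beq i a with _ | _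
    · rw [memB, hb, Bool.false_or] at h
      rw [cond_false, dv_cons, ← dv_erase i l h]; ring
    · rw [cond_true, Nat.eq_of_beq_eq_true hb]

/-- Value of a weight. -/
noncomputable def wv (w : Wt) : k := q ^ w.b * dv q w.num / dv q w.den

/-- The denominator does not vanish. -/
def WfW (w : Wt) : Prop := dv q w.den ≠ 0

lemma wv_addNum (i : ℕ) (w : Wt) (hw : WfW q w) :
    wv q (Wt.addNum i w) = wv q w * br q i ∧ WfW q (Wt.addNum i w) := by
  obtain ⟨b, num, den⟩ := w
  unfold WfW at *
  simp only at hw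
  rw [Wt.addNum]
  rcases h : memB i den with _ | _
  · simp only [cond_false, wv, dv_cons]
    exact ⟨by ring, hw⟩
  · have h1 := dv_erase q i den h
    rw [← h1] at hw
    have h2 := left_ne_zero_of_mul hw
    have h3 := right_ne_zero_of_mul hw
    simp only [cond_true, wv, ← h1]
    exact ⟨by field_simp, h3⟩

lemma wv_addDen (i : ℕ) (hi : br q i ≠ 0) (w : Wt) (hw : WfW q w) :
    wv q (Wt.addDen i w) = wv q w / br q i ∧ WfW q (Wt.addDen i w) := by
  obtain ⟨b, num, den⟩ := w
  unfold WfW at *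
  simp only at hw
  rw [Wt.addDen]
  rcases h : memB i num with _ | _
  · simp only [cond_false, wv, dv_cons]
    exact ⟨by field_simp, mul_ne_zero hi hw⟩
  · have h1 := dv_erase q i num h
    simp only [cond_true, wv, ← h1]
    exact ⟨by field_simp, hw⟩

lemma wv_shift (w : Wt) (hw : WfW q w) :
    wv q (Wt.shift w) = wv q w * q ∧ WfW q (Wt.shift w) := by
  obtain ⟨b, num, den⟩ := w
  refine ⟨?_, hw⟩
  simp only [Wt.shift, wv, pow_succ]
  ring

lemma wv_stepFactor (hq : ∀ n, 1 ≤ n → br q n ≠ 0) (c s : ℕ) (w : Wt) (hw : WfW q w) :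
    wv q (Wt.stepFactor c s w) = wv q w * hB q c s ∧ WfW q (Wt.stepFactor c s w) := by
  rw [Wt.stepFactor, hB]
  rcases h : Nat.beq (s + 1) c with _ | _
  · have h' : ¬ s + 1 = c := Nat.ne_of_beq_eq_false h
    rw [cond_false, if_neg h']
    rcases h2 : Nat.ble c s with _ | _
    · have h2' : ¬ c ≤ s := Nat.not_le_of_not_ble_eq_true (by rw [h2]; simp)
      rw [cond_false, if_neg h2']
      have a1 := wv_addNum q (c - s) w hw
      have a2 := wv_addDen q (c - s - 1) (hq _ (by omega)) _ a1.2
      exact ⟨by rw [a2.1, a1.1]; ring, a2.2⟩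
    · have h2' : c ≤ s := Nat.le_of_ble_eq_true h2
      rw [cond_true, if_pos h2']
      have a1 := wv_addNum q (s - c) w hw
      have a2 := wv_addDen q (s + 1 - c) (hq _ (by omega)) _ a1.2
      have a3 := wv_shift q _ a2.2
      exact ⟨by rw [a3.1, a2.1, a1.1]; ring, a3.2⟩
  · rw [cond_true, if_pos (Nat.eq_of_beq_eq_true h), mul_one]
    exact ⟨rfl, hw⟩

lemma wv_stepInit (hq : ∀ n, 1 ≤ n → br q n ≠ 0) (c : ℕ) (hc : 1 ≤ c) (w : Wt) (hw : WfW q w) :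
    wv q (Wt.stepInit c w) = wv q w * (if c = 1 then 1 else br q c / br q (c - 1)) ∧
      WfW q (Wt.stepInit c w) := by
  rw [Wt.stepInit]
  rcases h : Nat.beq c 1 with _ | _
  · have h' : ¬ c = 1 := Nat.ne_of_beq_eq_false h
    rw [cond_false, if_neg h']
    have a1 := wv_addNum q c w hw
    have a2 := wv_addDen q (c - 1) (hq _ (by omega)) _ a1.2
    exact ⟨by rw [a2.1, a1.1]; ring, a2.2⟩
  · rw [cond_true, if_pos (Nat.eq_of_beq_eq_true h), mul_one]
    exact ⟨rfl, hw⟩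

lemma wv_step (hq : ∀ n, 1 ≤ n → br q n ≠ 0) (c : ℕ) (hc : 1 ≤ c) (w : Wt) (hw : WfW q w) :
    ∀ l, wv q (Wt.step c w l) = wv q w * wB q l c ∧ WfW q (Wt.step c w l)
  | [] => by
    have := wv_stepInit q hq c hc w hw
    rw [Wt.step]
    refine ⟨?_, this.2⟩
    rw [this.1, wB]; simp
  | s :: l => by
    have ih := wv_step hq c hc w hw l
    have := wv_stepFactor q hq c s _ ih.2
    rw [Wt.step]
    refine ⟨?_, this.2⟩
    rw [this.1, ih.1, wB, wB, List.map_cons, List.prod_cons]; ring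

/-- Value of a coefficient list. -/
noncomputable def pv : List ℕ → k
  | [] => 0
  | a :: l => (a : k) + q * pv l

lemma pv_mem (S : Subsemiring k) (hS : q ∈ S) : ∀ l, pv q l ∈ S
  | [] => S.zero_mem
  | a :: l => S.add_mem (natCast_mem S a) (S.mul_mem hS (pv_mem S hS l))

lemma pv_pAdd : ∀ l m, pv q (pAdd l m) = pv q l + pv q m
  | [], m => by simp [pAdd, pv]
  | a :: l, [] => by simp [pAdd, pv]
  | a :: l, b :: m => by
    simp only [pAdd, pv, pv_pAdd l m, Nat.cast_add]; ring

lemma pv_pMulQ (m : List ℕ) : ∀ i, pv q (pMulQ m i) = pv q m * br q i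
  | 0 => by simp [pMulQ, pv, br_zero]
  | i + 1 => by
    simp only [pMulQ, pv_pAdd, pv, pv_pMulQ m i, br_succ, Nat.cast_zero]; ring

lemma pv_pProd (m : List ℕ) : ∀ l, pv q (pProd m l) = pv q m * dv q l
  | [] => by simp [pProd, dv_nil]
  | i :: l => by
    simp only [pProd, pv_pMulQ, pv_pProd m l, dv_cons]; ring

lemma pv_pShift (m : List ℕ) : ∀ b, pv q (pShift m b) = q ^ b * pv q m
  | 0 => by simp [pShift]
  | b + 1 => by
    simp only [pShift, pv, pv_pShift m b, pow_succ, Nat.cast_zero]; ring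

lemma pv_pZero : ∀ l, pZero l = true → pv q l = 0
  | [], _ => rfl
  | a :: l, h => by
    rw [pZero, Bool.and_eq_true, Nat.beq_eq] at h
    simp [pv, h.1, pv_pZero l h.2]

lemma pv_pEqv : ∀ l m, pEqv l m = true → pv q l = pv q m
  | [], m, h => by rw [pEqv] at h; rw [pv_pZero q m h]; rfl
  | a :: l, [], h => by rw [pEqv] at h; rw [pv_pZero q _ h]; rfl
  | a :: l, b :: m, h => by
    rw [pEqv, Bool.and_eq_true, Nat.beq_eq] at h
    simp [pv, h.1, pv_pEqv l m h.2]

lemma dv_splitB : ∀ l m, dv q (splitB l m).1 * dv q m = dv q (splitB l m).2 * dv q l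
  | [], m => by simp [splitB, dv_nil]
  | a :: l, m => by
    rw [splitB]
    rcases h : memB a m with _ | _
    · have ih := dv_splitB l m
      simp only [cond_false, dv_cons]
      rw [mul_assoc, ih]; ring
    · have ih := dv_splitB l (eraseB a m)
      simp only [cond_true, dv_cons]
      rw [← dv_erase q a m h, ← mul_assoc, mul_comm _ (br q a), mul_assoc, ih]; ring

lemma dv_splitB_ne : ∀ l m, dv q l ≠ 0 → dv q (splitB l m).1 ≠ 0
  | [], m, h => by simp [splitB, dv_nil]
  | a :: l, m, h => by
    rw [dv_cons] at h
    rw [splitB]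
    rcases h2 : memB a m with _ | _
    · simp only [cond_false, dv_cons]
      exact mul_ne_zero (left_ne_zero_of_mul h) (dv_splitB_ne l m (right_ne_zero_of_mul h))
    · simp only [cond_true]
      exact dv_splitB_ne l _ (right_ne_zero_of_mul h)

/-- Value of a fraction. -/
noncomputable def fv (f : List ℕ × List ℕ) : k := pv q f.1 / dv q f.2

lemma fv_addFrac (w : Wt) (hw : WfW q w) (f : List ℕ × List ℕ) (hf : dv q f.2 ≠ 0) :
    fv q (addFrac w f) = wv q w + fv q f ∧ dv q (addFrac w f).2 ≠ 0 := by
  have h1 := dv_splitB q w.den f.2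
  have h2 := dv_splitB_ne q w.den f.2 hw
  have h3 : dv q w.den ≠ 0 := hw
  have e : addFrac w f = (pAdd (pProd f.1 (splitB w.den f.2).1)
      (pShift (pProd (pProd [1] w.num) (splitB w.den f.2).2) w.b), (splitB w.den f.2).1 ++ f.2) := rfl
  rw [e]
  generalize (splitB w.den f.2).1 = x at *
  generalize (splitB w.den f.2).2 = y at *
  refine ⟨?_, by simp only [dv_append]; exact mul_ne_zero h2 hf⟩
  simp only [fv, wv, dv_append, pv_pAdd, pv_pProd, pv_pShift]
  have h4 : pv q [1] = 1 := by simp [pv]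
  rw [h4, div_add_div _ _ h3 hf, div_eq_div_iff (mul_ne_zero h2 hf) (mul_ne_zero h3 hf)]
  linear_combination (-(q ^ w.b * dv q w.num * dv q f.2) + 0) * h1

lemma fv_goodFrac (S : Subsemiring k) (hS : q ∈ S) (f : List ℕ × List ℕ) (hf : dv q f.2 ≠ 0)
    (h : goodFrac f = true) : fv q f ∈ S := by
  have h1 := pv_pEqv q _ _ h
  rw [pv_pProd] at h1
  rw [fv, ← h1, mul_div_cancel_right₀ _ hf]
  exact pv_mem q S hS _

variable (N : ℕ)

/-- Product of column variables. -/
noncomputable def yl (k : Type) [Field k] (N : ℕ) (cols : List ℕ) : MvPolynomial (Fin N) k :=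
  (cols.map (yv k N)).prod

lemma yl_ins (c : ℕ) : ∀ cols, yl k N (insSorted c cols) = yv k N c * yl k N cols
  | [] => by simp [insSorted, yl]
  | a :: l => by
    have ih := yl_ins c l
    rw [insSorted]
    cases Nat.ble c a
    · simp only [cond_false]
      unfold yl at *
      rw [List.map_cons, List.prod_cons, ih, List.map_cons, List.prod_cons]; ring
    · simp [yl]

/-- Polynomial of a node. -/
noncomputable def nodeP (ds : List ℕ) : List St → MvPolynomial (Fin N) k
  | [] => 0
  | s :: nd => MvPolynomial.C (wv q s.wt) * yl k N s.cols * ppoly N q ds s.win + nodeP ds nd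

/-- Well-formed nodes. -/
def WfN (n : ℕ) (nd : List St) : Prop := ∀ s ∈ nd, WfW q s.wt ∧ s.win.length = n

/-- The cost of a monomial. -/
noncomputable def cstH (N : ℕ) : (Fin N →₀ ℕ) →+ ℕ :=
  Finsupp.weight fun i : Fin N => colCost (i.val + 1)

/-- All coefficients of small cost vanish. -/
def NullP {N : ℕ} (P : MvPolynomial (Fin N) k) : Prop :=
  ∀ m, cstH N m ≤ 6 → MvPolynomial.coeff m P = 0

variable {N}

lemma NullP.zero : NullP (0 : MvPolynomial (Fin N) k) := fun m _ => coeff_zero m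

lemma NullP.add {P Q : MvPolynomial (Fin N) k} (hP : NullP P) (hQ : NullP Q) : NullP (P + Q) :=
  fun m hm => by rw [coeff_add, hP m hm, hQ m hm, add_zero]

lemma NullP.mul {P : MvPolynomial (Fin N) k} (hP : NullP P) (Q : MvPolynomial (Fin N) k) :
    NullP (P * Q) := fun m hm => by
  rw [coeff_mul]
  refine Finset.sum_eq_zero fun x hx => ?_
  have h := Finset.HasAntidiagonal.mem_antidiagonal.1 hx
  have h2 : cstH N x.1 + cstH N x.2 = cstH N m := by rw [← h, map_add]
  rw [hP _ (by omega), zero_mul]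

lemma yl_homog : ∀ (cols : List ℕ) (m : Fin N →₀ ℕ), MvPolynomial.coeff m (yl k N cols) ≠ 0 →
    cstH N m = listCost cols
  | [], m, h => by
    have : yl k N [] = 1 := rfl
    rw [this, coeff_one] at h
    have h0 : 0 = m := by
      by_contra h0
      rw [if_neg h0] at h
      exact h rfl
    rw [← h0, map_zero]; rfl
  | a :: l, m, h => by
    have e : yl k N (a :: l) = yv k N a * yl k N l := by simp [yl]
    rw [e, coeff_mul] at h
    obtain ⟨x, hx, h1⟩ := Finset.exists_ne_zero_of_sum_ne_zero h
    have h2 := Finset.HasAntidiagonal.mem_antidiagonal.1 hx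
    have h3 := yl_homog l x.2 (right_ne_zero_of_mul h1)
    have h4 := left_ne_zero_of_mul h1
    rw [← h2, map_add, h3, listCost]
    congr 1
    rw [yv] at h4
    split_ifs at h4 with h5
    · rw [coeff_X] at h4
      have h6 : Finsupp.single (⟨a - 1, by omega⟩ : Fin N) 1 = x.1 := by
        by_contra h0
        rw [if_neg h0] at h4
        exact h4 rfl
      rw [← h6, cstH, Finsupp.weight_single]
      have : a - 1 + 1 = a := by omega
      simp [this]
    · simp at h4

lemma extend_sound (hq : ∀ n, 1 ≤ n → br q n ≠ 0) (ds l cols : List ℕ) (w : Wt) (hw : WfW q w)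
    (acc : List St) (hacc : WfN q (l.length + 1) acc) : ∀ cs : List ℕ, (∀ c ∈ cs, 1 ≤ c) →
    WfN q (l.length + 1) (extend l cols w acc cs) ∧ ∃ R : MvPolynomial (Fin N) k, NullP R ∧
      nodeP q N ds acc + (cs.map fun c => MvPolynomial.C (wv q w) * yl k N cols *
        (MvPolynomial.C (wB q l c) * yv k N c * ppoly N q ds (l ++ [c]))).sum =
      nodeP q N ds (extend l cols w acc cs) + R
  | [], _ => ⟨hacc, 0, NullP.zero, by simp [extend]⟩
  | c :: cs, hcs => by
    obtain ⟨h1, R, hR, h2⟩ := extend_sound hq ds l cols w hw acc hacc cs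
      (fun a ha => hcs a (List.mem_cons_of_mem _ ha))
    have hc := hcs c List.mem_cons_self
    rw [extend, List.map_cons, List.sum_cons]
    rcases hb : Nat.ble (colCost c + listCost cols) 6 with _ | _
    · rw [cond_false]
      have hb' : ¬ colCost c + listCost cols ≤ 6 := Nat.not_le_of_not_ble_eq_true (by rw [hb]; simp)
      refine ⟨h1, yl k N (c :: cols) * (MvPolynomial.C (wv q w) * MvPolynomial.C (wB q l c) *
        ppoly N q ds (l ++ [c])) + R, NullP.add (NullP.mul ?_ _) hR, ?_⟩
      · intro m hm
        by_contra h0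
        have := yl_homog _ _ h0
        rw [listCost] at this
        omega
      · have e : yl k N (c :: cols) = yv k N c * yl k N cols := by simp [yl]
        rw [e]
        linear_combination h2
    · rw [cond_true]
      have hs := wv_step q hq c hc w hw l
      refine ⟨?_, R, hR, ?_⟩
      · intro s hs'
        rcases List.mem_cons.1 hs' with rfl | hs'
        · exact ⟨hs.2, by simp⟩
        · exact h1 s hs'
      · rw [nodeP]
        simp only
        rw [hs.1, yl_ins, map_mul]
        linear_combination h2

lemma nodeNext_sound (hq : ∀ n, 1 ≤ n → br q n ≠ 0) (ds : List ℕ) (n d : ℕ) (hd : d ≤ n) :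
    ∀ nd : List St, WfN q n nd → WfN q (n - d + 1) (nodeNext d nd) ∧
      ∃ R : MvPolynomial (Fin N) k, NullP R ∧
        nodeP q N (d :: ds) nd = nodeP q N ds (nodeNext d nd) + R
  | [], _ => ⟨fun s hs => by simp [nodeNext] at hs, 0, NullP.zero, by simp [nodeNext, nodeP]⟩
  | s :: nd, h => by
    obtain ⟨h1, R, hR, h2⟩ := nodeNext_sound hq ds n d hd nd
      (fun a ha => h a (List.mem_cons_of_mem _ ha))
    have hs := h s List.mem_cons_self
    have hl : (s.win.drop d).length = n - d := by rw [List.length_drop, hs.2]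
    obtain ⟨h3, R', hR', h4⟩ := extend_sound (N := N) q hq ds (s.win.drop d) s.cols s.wt hs.1 (nodeNext d nd)
      (by rw [hl]; exact h1) (cands (s.win.drop d)) (by
        intro c hc
        rw [cands, mem_succNotIn] at hc
        obtain ⟨_, a, _, h⟩ := hc
        omega)
    rw [hl] at h3
    refine ⟨h3, R + R', hR.add hR', ?_⟩
    rw [nodeP, h2, ppoly, ← List.sum_map_mul_left]
    rw [nodeNext]
    linear_combination h4

lemma nodeP_full (ds : List ℕ) (n : ℕ) : ∀ nd : List St, WfN q n nd →
    nodeP q N (n :: ds) nd = nodeP q N [] nd * ppoly N q (0 :: ds) []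
  | [], _ => by simp [nodeP]
  | s :: nd, h => by
    have ih := nodeP_full ds n nd (fun a ha => h a (List.mem_cons_of_mem _ ha))
    have hs := h s List.mem_cons_self
    have e : ppoly N q (n :: ds) s.win = ppoly N q (0 :: ds) [] := by
      rw [ppoly, ppoly, List.drop_eq_nil_of_le hs.2.le, List.drop_nil]
    rw [nodeP, nodeP, ih, e, ppoly]; ring

lemma sumFrac_sound (n : ℕ) (cols : List ℕ) : ∀ nd : List St, WfN q n nd →
    dv q (sumFrac cols nd).2 ≠ 0 ∧ WfN q n (others cols nd) ∧
    nodeP q N [] nd = MvPolynomial.C (fv q (sumFrac cols nd)) * yl k N cols +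
      nodeP q N [] (others cols nd)
  | [], h => by
    refine ⟨by simp [sumFrac, dv_nil], h, ?_⟩
    simp [sumFrac, fv, pv, nodeP, others]
  | s :: nd, h => by
    obtain ⟨h1, h2, h3⟩ := sumFrac_sound n cols nd (fun a ha => h a (List.mem_cons_of_mem _ ha))
    have hs := h s List.mem_cons_self
    rw [sumFrac, others]
    rcases hb : eqB s.cols cols with _ | _
    · simp only [cond_false]
      refine ⟨h1, ?_, ?_⟩
      · intro a ha
        rcases List.mem_cons.1 ha with rfl | ha
        · exact hs
        · exact h2 a ha
      · rw [nodeP, h3, nodeP]; ring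
    · simp only [cond_true]
      have a1 := fv_addFrac q s.wt hs.1 _ h1
      refine ⟨a1.2, h2, ?_⟩
      rw [nodeP, h3, a1.1, eqB_iff _ _ hb, map_add, ppoly]; ring

variable (S : Subsemiring k) (hS : q ∈ S)

lemma good_yl (cols : List ℕ) : GoodP S (cstH N) 6 (yl k N cols) := by
  induction cols with
  | nil => exact GoodP.one
  | cons a l ih =>
    have e : yl k N (a :: l) = yv k N a * yl k N l := by simp [yl]
    rw [e]; exact (GoodP.yv a).mul ih

lemma checkNode_sound (hS : q ∈ S) (n : ℕ) : ∀ (f : ℕ) (nd : List St), WfN q n nd →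
    checkNode f nd = true → GoodP S (cstH N) 6 (nodeP q N [] nd)
  | _, [], _, _ => by rw [nodeP]; exact GoodP.zero
  | 0, _ :: _, _, h => by simp [checkNode] at h
  | f + 1, s :: nd, hw, h => by
    rw [checkNode, Bool.and_eq_true] at h
    obtain ⟨h1, h2, h3⟩ := sumFrac_sound (N := N) q n s.cols (s :: nd) hw
    have e : others s.cols (s :: nd) = others s.cols nd := by
      rw [others]
      have : ∀ l, eqB l l = true := fun l => by
        induction l with
        | nil => rfl
        | cons a l ih => rw [eqB, ih, Bool.and_true]; exact Nat.beq_refl a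
      rw [this, cond_true]
    rw [e] at h2 h3
    rw [h3]
    exact ((GoodP.C (fv_goodFrac q S hS _ h1 h.1)).mul (good_yl S _)).add
      (checkNode_sound hS n f _ h2 h.2)

lemma allBelow_iff (test : ℕ → Bool) : ∀ n, allBelow test n = true → ∀ d, d < n → test d = true
  | 0, _, d, hd => by omega
  | n + 1, h, d, hd => by
    rw [allBelow, Bool.and_eq_true] at h
    rcases Nat.lt_succ_iff_lt_or_eq.1 hd with h1 | rfl
    · exact allBelow_iff test n h.2 d h1
    · exact h.1

lemma good_of_null {P Q R : MvPolynomial (Fin N) k} (hR : NullP R) (h : P = Q + R)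
    (hQ : GoodP S (cstH N) 6 Q) : GoodP S (cstH N) 6 P := fun m hm => by
  rw [h, coeff_add, hR m hm, add_zero]; exact hQ m hm

lemma checkTree_sound (hS : q ∈ S) (hq : ∀ n, 1 ≤ n → br q n ≠ 0) (M : ℕ)
    (hM : ∀ ds : List ℕ, ds.length ≤ M → legal 0 ds → GoodP S (cstH N) 6 (ppoly N q ds [])) :
    ∀ (f n : ℕ) (nd : List St), WfN q n nd → checkTree f n nd = true →
      ∀ ds : List ℕ, ds.length ≤ M → legal n ds → GoodP S (cstH N) 6 (nodeP q N ds nd)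
  | _, _, [], _, _, ds, _, _ => by rw [nodeP]; exact GoodP.zero
  | 0, _, _ :: _, _, h, _, _, _ => by simp [checkTree] at h
  | f + 1, n, s :: nd, hw, h, ds, hl, hds => by
    rw [checkTree, Bool.and_eq_true] at h
    have h0 := checkNode_sound (N := N) q S hS n 40 _ hw h.1
    rcases ds with _ | ⟨d, ds⟩
    · exact h0
    · obtain ⟨hd, hds'⟩ := hds
      rcases hd.eq_or_lt with rfl | hd'
      · rw [nodeP_full q ds d _ hw]
        refine h0.mul (hM _ (by simpa using hl) ⟨le_rfl, ?_⟩)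
        simpa using hds'
      · obtain ⟨h1, R, hR, h2⟩ := nodeNext_sound (N := N) q hq ds n d hd _ hw
        refine good_of_null S hR h2 ?_
        exact checkTree_sound hS hq M hM f _ _ h1 (allBelow_iff _ n h.2 d hd') ds
          (by simp only [List.length_cons] at hl; omega) hds'

theorem ppoly_good (hS : q ∈ S) (hq : ∀ n, 1 ≤ n → br q n ≠ 0) (hchk : checkTree 12 1 startNode = true) :
    ∀ (M : ℕ) (ds : List ℕ), ds.length ≤ M → legal 0 ds → GoodP S (cstH N) 6 (ppoly N q ds [])
  | _, [], _, _ => by rw [ppoly]; exact GoodP.one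
  | 0, _ :: _, h, _ => by simp at h
  | M + 1, d :: ds, hl, hds => by
    obtain ⟨hd, hds'⟩ := hds
    obtain rfl : d = 0 := by omega
    have h := checkTree_sound (N := N) q S hS hq M (fun ds' => ppoly_good hS hq hchk M ds') 12 1 startNode
      (by
        intro s hs
        simp only [startNode, List.mem_singleton] at hs
        subst hs
        exact ⟨by simp [WfW, dv_nil], rfl⟩) hchk ds (by simpa using hl) (by simpa using hds')
    have e : nodeP q N ds startNode = ppoly N q (0 :: ds) [] := by
      have e1 : cands [] = [1] := by decide
      rw [ppoly, List.drop_nil, e1]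
      simp [startNode, nodeP, wv, dv_nil, yl, wB]
    rwa [← e]

end Sound

/-! ### The first part -/

set_option maxRecDepth 100000 in
theorem check_ok : checkTree 12 1 startNode = true := by decide +kernel

lemma sum_colCost (N a : ℕ) : cstH N (expo1 N a) ≤ if a = 1 then 0 else a := by
  have h1 : cstH N (expo1 N a) = ∑ i : Fin N, (if i.val < a then colCost (i.val + 1) else 0) := by
    rw [cstH, Finsupp.weight_apply, Finsupp.sum_fintype _ _ (by simp)]
    refine Finset.sum_congr rfl fun i _ => ?_
    simp only [expo1, Finsupp.equivFunOnFinite_symm_apply_apply]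
    split_ifs <;> simp
  have h2 : ∀ a, ∑ i ∈ Finset.range a, colCost (i + 1) ≤ if a = 1 then 0 else a := by
    have h3 : ∀ a, ∑ i ∈ Finset.range (a + 2), colCost (i + 1) = a + 2 := by
      intro a
      induction a with
      | zero => rfl
      | succ a ih => rw [Finset.sum_range_succ, ih]; rfl
    intro a
    rcases a with _ | _ | a
    · simp
    · simp [colCost]
    · rw [h3]; simp
  refine le_trans ?_ (h2 a)
  rw [h1, Fin.sum_univ_eq_sum_range (fun i => if i < a then colCost (i + 1) else 0) N,
    ← Finset.sum_filter]
  refine Finset.sum_le_sum_of_subset fun i hi => ?_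
  simp only [Finset.mem_filter, Finset.mem_range] at hi
  exact Finset.mem_range.2 hi.2

lemma cst_expo {n w m N : ℕ} (μ : Nat.Partition w) (p : Nat.Partition n)
    (hshape : p.parts = μ.parts + Multiset.replicate m 1) : cstH N (expo N p) ≤ w := by
  have h1 : ∀ s : Multiset ℕ, cstH N (s.map (expo1 N)).sum ≤ s.sum := by
    intro s
    induction s using Multiset.induction_on with
    | empty => simp
    | cons a s ih =>
      rw [Multiset.map_cons, Multiset.sum_cons, map_add, Multiset.sum_cons]
      have := sum_colCost N a
      split_ifs at this <;> omega
  have h2 : ∀ m, cstH N ((Multiset.replicate m 1).map (expo1 N)).sum = 0 := by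
    intro m
    have := sum_colCost N 1
    have h0 : cstH N (expo1 N 1) = 0 := by simpa using this
    rw [Multiset.map_replicate, Multiset.sum_replicate, map_nsmul, h0, smul_zero]
  rw [expo, hshape, Multiset.map_add, Multiset.sum_add, map_add, h2, add_zero]
  exact (h1 _).trans μ.parts_sum.le

theorem first_part (n N : ℕ) (hN : n ≤ N) (w : ℕ) (μ : Nat.Partition w) (m : ℕ)
    (p : Nat.Partition n) (hshape : p.parts = μ.parts + Multiset.replicate m 1)
    (G : SimpleGraph (Fin n)) (hG : IsNUIG G) (hw : w ≤ 6) (c : Nat.Partition n → Polynomial ℤ)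
    (h : chromQSym n N G = ∑ q : Nat.Partition n, MvPolynomial.C (c q) * eProd N (Polynomial ℤ) q)
    (i : ℕ) : 0 ≤ (c p).coeff i := by
  let k := FractionRing (Polynomial ℤ)
  let ψ : Polynomial ℤ →+* k := algebraMap (Polynomial ℤ) k
  have hψ : Function.Injective ψ := IsFractionRing.injective _ _
  let φ : Polynomial ℕ →+* k := ψ.comp (Polynomial.mapRingHom (Nat.castRingHom ℤ))
  let q : k := ψ Polynomial.X
  have hqφ : φ Polynomial.X = q := by simp [φ, q]
  have hq0 : q ≠ 0 := by
    intro h0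
    exact Polynomial.X_ne_zero (hψ (h0.trans (map_zero ψ).symm))
  have hq1 : ∀ n, 1 ≤ n → q ^ n ≠ 1 := by
    intro n hn h0
    have h1 : (Polynomial.X : Polynomial ℤ) ^ n = 1 := hψ (by rw [map_pow, map_one]; exact h0)
    have h2 := congrArg Polynomial.natDegree h1
    rw [Polynomial.natDegree_X_pow, Polynomial.natDegree_one] at h2
    omega
  have h4 : chromK n N G q = ∑ p : Nat.Partition n, MvPolynomial.C (ψ (c p)) * eProd N k p := by
    have h5 := congrArg (MvPolynomial.map ψ) h
    have e1 : MvPolynomial.map ψ (chromQSym n N G) = chromK n N G q := by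
      rw [chromQSym, chromK, map_sum]
      refine Finset.sum_congr rfl fun κ _ => ?_
      split_ifs
      · rw [map_mul, MvPolynomial.map_C, map_prod, map_pow ψ]
        simp only [MvPolynomial.map_X]
        rfl
      · rw [map_zero]
    rw [← e1, h5, map_sum]
    refine Finset.sum_congr rfl fun p _ => ?_
    rw [map_mul, MvPolynomial.map_C, eProd, eProd, map_multiset_prod, Multiset.map_map]
    simp [Function.comp_def, map_esymm]
  have h5 := coeff_ppoly hN G hG q hq0 hq1 (fun p => ψ (c p)) h4 p
  have h6 := ppoly_good (N := N) q φ.rangeS ⟨Polynomial.X, hqφ⟩ (br_ne q hq1) check_ok _ (wordG G) le_rfl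
    (wordG_legal G hG) (expo N p) ((cst_expo μ p hshape).trans hw)
  rw [h5] at h6
  obtain ⟨P, hP⟩ := h6
  have h7 : Polynomial.mapRingHom (Nat.castRingHom ℤ) P = c p := hψ hP
  rw [← h7, Polynomial.coe_mapRingHom, Polynomial.coeff_map]
  exact Int.natCast_nonneg _


/-- if `λ = (μ_1,…,μ_k,1,…,1)` for a partition `μ`, then for every
natural unit interval graph `G`: if `|μ| ≤ 6` then `c_λ(q)` has nonnegative
coefficients, and if `|μ| ≤ 11` then `c_λ ≥ 0`. -/
theorem stmt4 (n N : ℕ) (hN : n ≤ N) (w : ℕ) (μ : Nat.Partition w) (m : ℕ)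
    (p : Nat.Partition n)
    (hshape : p.parts = μ.parts + Multiset.replicate m 1)
    (G : SimpleGraph (Fin n)) (hG : IsNUIG G) :
    (w ≤ 6 → ∀ c : Nat.Partition n → Polynomial ℤ,
      chromQSym n N G = ∑ q : Nat.Partition n, C (c q) * eProd N (Polynomial ℤ) q →
      ∀ k, 0 ≤ (c p).coeff k) ∧
    (w ≤ 11 → ∀ c : Nat.Partition n → ℤ,
      chromSym n N G = ∑ q : Nat.Partition n, C (c q) * eProd N ℤ q →
      0 ≤ c p) := by
  exact ⟨fun hw c h k => first_part n N hN w μ m p hshape G hG hw c h k,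
    fun _ c h => second_part n N hN p G hG c h⟩
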